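/- arXiv:1003.5996 — 2 statements merged into one kernel-verified Lean document; each statement's English description precedes it below -/
import Mathlib

section
/- Let k ≥ 1 be a natural number and let a, b > 0 be fixed real numbers (independent of N). Then, as N → ∞, I_k(N;a,b)/N converges to binom(2k,k)/4^k. -/
open Finset MeasureTheory

/-- The Jacobi-ensemble average `⟨f⟩_{a,b}` over `[0,1]^N`. -/
noncomputable def jacobiAvg (N : ℕ) (a b : ℝ) (f : (Fin N → ℝ) → ℝ) : ℝ :=
  ((N.factorial : ℝ))⁻¹ *
    ∫ x in Set.univ.pi (fun _ : Fin N => Set.Icc (0 : ℝ) 1),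
      f x * (∏ i, ∏ j ∈ Finset.Ioi i, (x i - x j) ^ 2) *
        ∏ i, x i ^ (a - 1) * (1 - x i) ^ (b - 1)

/-- `I_k = ⟨p_k⟩_{a,b} / ⟨1⟩_{a,b}` where `p_k` is the `k`-th power sum. -/
noncomputable def Ik (k N : ℕ) (a b : ℝ) : ℝ :=
  jacobiAvg N a b (fun x => ∑ i, x i ^ k) / jacobiAvg N a b (fun _ => 1)

/-- The `n`-th coefficient of the Cauchy square of the sequence `m`. -/
noncomputable def selfConv (m : ℕ → ℝ) (n : ℕ) : ℝ :=
  ∑ ij ∈ antidiagonal n, m ij.1 * m ij.2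

/-- The moments of the arcsine law on `[0,1]`. -/
noncomputable def arcsineMoment (k : ℕ) : ℝ := (k.centralBinom : ℝ) / 4 ^ k

lemma arcsineMoment_zero : arcsineMoment 0 = 1 := by simp [arcsineMoment]

lemma arcsineMoment_nonneg (k : ℕ) : 0 ≤ arcsineMoment k := by
  unfold arcsineMoment; positivity

lemma arcsineMoment_le_one (k : ℕ) : arcsineMoment k ≤ 1 := by
  unfold arcsineMoment
  rw [div_le_one (by positivity)]
  exact_mod_cast Nat.centralBinom_le_four_pow k

lemma arcsineMoment_succ (n : ℕ) :
    2 * ((n : ℝ) + 1) * arcsineMoment (n + 1) = (2 * n + 1) * arcsineMoment n := by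
  have h := congrArg (Nat.cast : ℕ → ℝ) (Nat.succ_mul_centralBinom_succ n)
  push_cast at h
  unfold arcsineMoment
  rw [pow_succ]
  field_simp
  linarith

lemma selfConv_arcsineMoment (n : ℕ) : selfConv arcsineMoment n = 1 := by
  induction n with
  | zero => simp [selfConv, arcsineMoment_zero]
  | succ n ih =>
    have sym : ∀ k : ℕ, ∑ ij ∈ antidiagonal k, (ij.2 : ℝ) * (arcsineMoment ij.1 * arcsineMoment ij.2)
        = ∑ ij ∈ antidiagonal k, (ij.1 : ℝ) * (arcsineMoment ij.1 * arcsineMoment ij.2) := by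
      intro k
      rw [← Nat.sum_antidiagonal_swap]
      exact sum_congr rfl fun ij _ => by simp [mul_comm]
    have weight : ∀ k : ℕ, (k : ℝ) * selfConv arcsineMoment k
        = 2 * ∑ ij ∈ antidiagonal k, (ij.1 : ℝ) * (arcsineMoment ij.1 * arcsineMoment ij.2) := by
      intro k
      rw [two_mul]
      nth_rewrite 1 [← sym k]
      rw [← sum_add_distrib, selfConv, mul_sum]
      refine sum_congr rfl fun ij hij => ?_
      rw [← mem_antidiagonal.1 hij]
      push_cast
      ring
    have h1 := weight (n + 1)
    rw [Nat.sum_antidiagonal_succ] at h1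
    have h2 : (2 : ℝ) * ∑ ij ∈ antidiagonal n,
        ((ij.1 + 1 : ℕ) : ℝ) * (arcsineMoment (ij.1 + 1) * arcsineMoment ij.2)
        = (n : ℝ) * selfConv arcsineMoment n + selfConv arcsineMoment n := by
      rw [weight n, selfConv, mul_sum, mul_sum, ← sum_add_distrib]
      refine sum_congr rfl fun ij _ => ?_
      have := arcsineMoment_succ ij.1
      push_cast
      linear_combination arcsineMoment ij.2 * this
    push_cast at h1 h2
    have h3 : ((n : ℝ) + 1) * selfConv arcsineMoment (n + 1) = (n + 1) * 1 := by
      rw [h1]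
      rw [ih] at h2
      linarith
    exact mul_left_cancel₀ (by positivity) h3

lemma selfConv_sub_one_le (m : ℕ → ℝ) (h0 : m 0 = 1) (k : ℕ) :
    |selfConv m k - 1| ≤ ∑ n ∈ range k, |selfConv m n - selfConv m (n + 1)| := by
  have h : 1 - selfConv m k = ∑ n ∈ range k, (selfConv m n - selfConv m (n + 1)) := by
    rw [sum_range_sub']
    simp [selfConv, h0]
  rw [abs_sub_comm, h]
  exact abs_sum_le_sum_abs _ _

lemma selfConv_succ_eq (m : ℕ → ℝ) (h0 : m 0 = 1) (k : ℕ) :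
    selfConv m (k + 1) = 2 * m (k + 1) + ∑ i ∈ range k, m (i + 1) * m (k - i) := by
  rw [selfConv, Nat.sum_antidiagonal_eq_sum_range_succ (fun i j => m i * m j), sum_range_succ,
    sum_range_succ']
  simp only [h0, Nat.sub_self, Nat.sub_zero, Nat.add_sub_add_right]
  ring

/-- Stability: a bounded sequence whose Cauchy square is almost constant is close to the
sequence of moments of the arcsine law. -/
lemma exists_abs_sub_arcsineMoment_le (k : ℕ) :
    ∃ C : ℝ, 0 ≤ C ∧ ∀ m : ℕ → ℝ, m 0 = 1 → (∀ j, |m j| ≤ 1) →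
      |m k - arcsineMoment k| ≤ C * ∑ n ∈ range k, |selfConv m n - selfConv m (n + 1)| := by
  induction k using Nat.strong_induction_on with
  | _ k ih =>
    rcases k with _ | k
    · exact ⟨0, le_rfl, fun m h0 _ => by simp [h0, arcsineMoment_zero]⟩
    choose! C hC hm using ih
    refine ⟨1 + ∑ i ∈ range k, (C (i + 1) + C (k - i)), ?_, fun m h0 hb => ?_⟩
    · refine add_nonneg zero_le_one (sum_nonneg fun i hi => ?_)
      have := mem_range.1 hi
      exact add_nonneg (hC _ (by omega)) (hC _ (by omega))
    set δ := ∑ n ∈ range (k + 1), |selfConv m n - selfConv m (n + 1)| with hδ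
    have hδ0 : 0 ≤ δ := sum_nonneg fun _ _ => abs_nonneg _
    have close : ∀ j < k + 1, |m j - arcsineMoment j| ≤ C j * δ := by
      intro j hj
      refine (hm j hj m h0 hb).trans (mul_le_mul_of_nonneg_left ?_ (hC j hj))
      exact sum_le_sum_of_subset_of_nonneg (range_subset_range.2 hj.le) fun _ _ _ => abs_nonneg _
    have hS := selfConv_sub_one_le m h0 (k + 1)
    have e1 := selfConv_succ_eq m h0 k
    have e2 := selfConv_succ_eq arcsineMoment arcsineMoment_zero k
    rw [selfConv_arcsineMoment] at e2
    have hprod : |∑ i ∈ range k, (m (i + 1) * m (k - i)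
        - arcsineMoment (i + 1) * arcsineMoment (k - i))|
        ≤ (∑ i ∈ range k, (C (i + 1) + C (k - i))) * δ := by
      rw [sum_mul]
      refine (abs_sum_le_sum_abs _ _).trans (sum_le_sum fun i hi => ?_)
      have hik := mem_range.1 hi
      have h1 := close (i + 1) (by omega)
      have h2 := close (k - i) (by omega)
      have split : m (i + 1) * m (k - i) - arcsineMoment (i + 1) * arcsineMoment (k - i)
          = (m (i + 1) - arcsineMoment (i + 1)) * m (k - i)
            + arcsineMoment (i + 1) * (m (k - i) - arcsineMoment (k - i)) := by ring
      rw [split, add_mul]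
      refine (abs_add_le _ _).trans (add_le_add ?_ ?_)
      · rw [abs_mul]
        exact (mul_le_of_le_one_right (abs_nonneg _) (hb _)).trans h1
      · rw [abs_mul, abs_of_nonneg (arcsineMoment_nonneg _)]
        exact (mul_le_of_le_one_left (abs_nonneg _) (arcsineMoment_le_one _)).trans h2
    rw [sum_sub_distrib] at hprod
    rw [← hδ] at hS
    rw [add_mul, one_mul]
    rw [abs_le] at hprod hS ⊢
    have hpos : 0 ≤ (∑ i ∈ range k, (C (i + 1) + C (k - i))) * δ := by
      linarith [hprod.1, hprod.2]
    constructor <;> linarith [hprod.1, hprod.2, hS.1, hS.2]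

/-- The weight `t ^ (a - 1) (1 - t) ^ (b - 1)` of the Jacobi ensemble. -/
noncomputable def jacobiWeight (a b t : ℝ) : ℝ := t ^ (a - 1) * (1 - t) ^ (b - 1)

/-- The unit cube `[0,1]^N`. -/
def unitCube (N : ℕ) : Set (Fin N → ℝ) := Set.univ.pi fun _ => Set.Icc (0 : ℝ) 1

/-- The product of the one-variable Jacobi weights. -/
noncomputable def jacobiProdWeight {N : ℕ} (a b : ℝ) (x : Fin N → ℝ) : ℝ :=
  ∏ i, jacobiWeight a b (x i)

/-- The function `h (t) = t ^ (n + 1) (1 - t)`, which vanishes at both end points of `[0,1]`. -/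
def testFun (n : ℕ) (t : ℝ) : ℝ := t ^ (n + 1) * (1 - t)

/-- The quotient `(h w)' / w` for `h = testFun n` and `w` the Jacobi weight. -/
def testDrift (n : ℕ) (a b t : ℝ) : ℝ := (n + a) * t ^ n * (1 - t) - b * t ^ (n + 1)

lemma isCompact_unitCube (N : ℕ) : IsCompact (unitCube N) :=
  isCompact_univ_pi fun _ => isCompact_Icc

lemma measurableSet_unitCube (N : ℕ) : MeasurableSet (unitCube N) :=
  (isCompact_unitCube N).measurableSet

lemma restrict_unitCube (N : ℕ) :
    (volume : Measure (Fin N → ℝ)).restrict (unitCube N)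
      = Measure.pi fun _ : Fin N => (volume : Measure ℝ).restrict (Set.Icc 0 1) := by
  rw [volume_pi, unitCube, Measure.restrict_pi_pi]

lemma integrableOn_jacobiWeight {a b : ℝ} (ha : 0 < a) (hb : 0 < b) :
    IntegrableOn (jacobiWeight a b) (Set.Icc 0 1) := by
  have h := Complex.betaIntegral_convergent (u := a) (v := b) (by simpa) (by simpa)
  rw [intervalIntegrable_iff_integrableOn_Icc_of_le zero_le_one] at h
  refine (Integrable.re h).congr (ae_restrict_of_forall_mem measurableSet_Icc fun t ht => ?_)
  have h1 : (0 : ℝ) ≤ 1 - t := by linarith [ht.2]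
  have e1 : (t : ℂ) ^ ((a : ℂ) - 1) = ((t ^ (a - 1) : ℝ) : ℂ) := by
    rw [Complex.ofReal_cpow ht.1]; push_cast; rfl
  have e2 : (1 - (t : ℂ)) ^ ((b : ℂ) - 1) = (((1 - t) ^ (b - 1) : ℝ) : ℂ) := by
    rw [Complex.ofReal_cpow h1]; push_cast; rfl
  simp only [e1, e2, ← Complex.ofReal_mul]
  simp [jacobiWeight]

lemma integrableOn_mul_jacobiProdWeight {N : ℕ} {a b : ℝ} (ha : 0 < a) (hb : 0 < b)
    {f : (Fin N → ℝ) → ℝ} (hf : Continuous f) :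
    IntegrableOn (fun x => f x * jacobiProdWeight a b x) (unitCube N) := by
  refine IntegrableOn.continuousOn_mul hf.continuousOn ?_ (isCompact_unitCube N)
  rw [IntegrableOn, restrict_unitCube]
  exact Integrable.fintype_prod fun _ => integrableOn_jacobiWeight ha hb

lemma integral_deriv_mul_jacobiWeight (n : ℕ) {a b : ℝ} (ha : 0 < a) (hb : 0 < b) {g g' : ℝ → ℝ}
    (hg : ∀ t, HasDerivAt g (g' t) t) (hg' : Continuous g') :
    ∫ t in Set.Icc 0 1, (testFun n t * g' t + testDrift n a b t * g t) * jacobiWeight a b t = 0 := by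
  have hgc : Continuous g := continuous_iff_continuousAt.2 fun t => (hg t).continuousAt
  rw [integral_Icc_eq_integral_Ioc, ← intervalIntegral.integral_of_le zero_le_one]
  rw [intervalIntegral.integral_eq_sub_of_hasDerivAt_of_le zero_le_one
    (f := fun t => t ^ n * t ^ a * (1 - t) ^ b * g t)]
  · simp [Real.zero_rpow ha.ne', Real.zero_rpow hb.ne']
  · refine Continuous.continuousOn ?_
    have h1 : Continuous fun t : ℝ => t ^ a := Real.continuous_rpow_const ha.le
    have h2 : Continuous fun t : ℝ => (1 - t) ^ b :=
      (Real.continuous_rpow_const hb.le).comp (by fun_prop)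
    fun_prop
  · intro t ht
    have ht1 : 0 < 1 - t := by linarith [ht.2]
    have d1 := hasDerivAt_pow n t
    have d2 := Real.hasDerivAt_rpow_const (x := t) (p := a) (Or.inl ht.1.ne')
    have d3 := (((hasDerivAt_id t).const_sub 1).rpow_const (p := b) (Or.inl ht1.ne'))
    refine (((d1.mul d2).mul d3).mul (hg t)).congr_deriv ?_
    have ea : t ^ a = t ^ (a - 1) * t := by
      rw [← Real.rpow_add_one ht.1.ne', sub_add_cancel]
    have eb : (1 - t) ^ b = (1 - t) ^ (b - 1) * (1 - t) := by
      rw [← Real.rpow_add_one ht1.ne', sub_add_cancel]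
    simp only [id, Pi.mul_apply, ea, eb, testFun, testDrift, jacobiWeight]
    rcases n with _ | n
    · simp
      ring
    · simp only [Nat.add_sub_cancel]
      push_cast
      ring
  · rw [intervalIntegrable_iff_integrableOn_Icc_of_le zero_le_one]
    refine IntegrableOn.continuousOn_mul (Continuous.continuousOn ?_)
      (integrableOn_jacobiWeight ha hb) isCompact_Icc
    unfold testFun testDrift
    fun_prop

lemma hasDerivAt_insertNth {m : ℕ} (i : Fin (m + 1)) (y : Fin m → ℝ) (t : ℝ) :
    HasDerivAt (fun s : ℝ => (i.insertNth s y : Fin (m + 1) → ℝ)) (Pi.single i 1) t := by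
  rw [hasDerivAt_pi, i.forall_iff_succAbove]
  refine ⟨?_, fun j => ?_⟩
  · simpa only [Fin.insertNth_apply_same, Pi.single_eq_same] using hasDerivAt_id' t
  · simpa [Fin.succAbove_ne] using hasDerivAt_const t (y j)

lemma integral_partial_deriv_mul_jacobiProdWeight (n : ℕ) {N : ℕ} {a b : ℝ} (ha : 0 < a)
    (hb : 0 < b) {G : (Fin N → ℝ) → ℝ} (hG : ContDiff ℝ 1 G) (i : Fin N) :
    ∫ x in unitCube N, (testFun n (x i) * fderiv ℝ G x (Pi.single i 1)
      + testDrift n a b (x i) * G x) * jacobiProdWeight a b x = 0 := by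
  obtain _ | m := N
  · exact i.elim0
  have hG' : Continuous fun x => fderiv ℝ G x (Pi.single i 1) :=
    (hG.continuous_fderiv one_ne_zero).clm_apply continuous_const
  have hGc := hG.continuous
  have hint : IntegrableOn (fun x : Fin (m + 1) → ℝ =>
      (testFun n (x i) * fderiv ℝ G x (Pi.single i 1)
      + testDrift n a b (x i) * G x) * jacobiProdWeight a b x) (unitCube (m + 1)) := by
    refine integrableOn_mul_jacobiProdWeight ha hb ?_
    unfold testFun testDrift
    fun_prop
  rw [IntegrableOn, restrict_unitCube] at hint
  rw [restrict_unitCube]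
  have mp := (measurePreserving_piFinSuccAbove
    (fun _ : Fin (m + 1) => (volume : Measure ℝ).restrict (Set.Icc 0 1)) i).symm
  rw [← mp.integrable_comp_emb (MeasurableEquiv.measurableEmbedding _)] at hint
  rw [← mp.integral_comp']
  refine (integral_prod_symm _ hint).trans ?_
  refine integral_eq_zero_of_ae (Filter.Eventually.of_forall fun y => ?_)
  simp only [Function.comp_apply, MeasurableEquiv.piFinSuccAbove_symm_apply,
    Fin.insertNthEquiv, Equiv.coe_fn_mk,
    Fin.insertNth_apply_same, jacobiProdWeight, Fin.prod_univ_succAbove _ i,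
    Fin.insertNth_apply_succAbove, ← mul_assoc, Pi.zero_apply]
  rw [integral_mul_const]
  have hc : Continuous fun t : ℝ => (i.insertNth t y : Fin (m + 1) → ℝ) :=
    continuous_iff_continuousAt.2 fun t => (hasDerivAt_insertNth i y t).continuousAt
  rw [integral_deriv_mul_jacobiWeight n ha hb (g := fun t => G (i.insertNth t y))
    (g' := fun t => fderiv ℝ G (i.insertNth t y) (Pi.single i 1)), zero_mul]
  · intro t
    exact ((hG.differentiable one_ne_zero _).hasFDerivAt).comp_hasDerivAt t
      (hasDerivAt_insertNth i y t)
  · exact hG'.comp hc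

lemma integral_fderiv_mul_jacobiProdWeight (n : ℕ) {N : ℕ} {a b : ℝ} (ha : 0 < a)
    (hb : 0 < b) {G : (Fin N → ℝ) → ℝ} (hG : ContDiff ℝ 1 G) :
    ∫ x in unitCube N, (fderiv ℝ G x (fun i => testFun n (x i))
      + G x * ∑ i, testDrift n a b (x i)) * jacobiProdWeight a b x = 0 := by
  have hG' : ∀ i, Continuous fun x => fderiv ℝ G x (Pi.single i 1) := fun i =>
    (hG.continuous_fderiv one_ne_zero).clm_apply continuous_const
  have hGc := hG.continuous
  have hsum := Finset.sum_eq_zero fun i (_ : i ∈ univ) =>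
    integral_partial_deriv_mul_jacobiProdWeight n ha hb hG i
  rw [← integral_finsetSum] at hsum
  · rw [← hsum]
    congr 1 with x
    rw [← sum_mul, sum_add_distrib, mul_sum]
    congr 2
    · rw [← ContinuousLinearMap.coe_coe, LinearMap.pi_apply_eq_sum_univ]
      refine sum_congr rfl fun i _ => ?_
      rw [smul_eq_mul]
      congr 2
      ext j
      simp [Pi.single_apply, eq_comm]
    · exact sum_congr rfl fun i _ => mul_comm _ _
  · intro i _
    refine integrableOn_mul_jacobiProdWeight ha hb ?_
    have := hG' i
    unfold testFun testDrift
    fun_prop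

/-- The squared Vandermonde product. -/
def vandermondeSq {N : ℕ} (x : Fin N → ℝ) : ℝ := ∏ i, ∏ j ∈ Ioi i, (x i - x j) ^ 2

/-- The power sum `p_r`. -/
def powerSum (r : ℕ) {N : ℕ} (x : Fin N → ℝ) : ℝ := ∑ i, x i ^ r

/-- The divided difference of `testFun n`. -/
def testQuot (n : ℕ) (s t : ℝ) : ℝ :=
  ∑ ij ∈ antidiagonal n, s ^ ij.1 * t ^ ij.2 - ∑ ij ∈ antidiagonal (n + 1), s ^ ij.1 * t ^ ij.2

/-- The leading term of the `n`-th loop equation. -/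
noncomputable def loopTerm (n : ℕ) {N : ℕ} (x : Fin N → ℝ) : ℝ :=
  selfConv (fun r => powerSum r x) n - selfConv (fun r => powerSum r x) (n + 1)

lemma sub_mul_sum_antidiagonal (n : ℕ) (s t : ℝ) :
    (s - t) * ∑ ij ∈ antidiagonal n, s ^ ij.1 * t ^ ij.2 = s ^ (n + 1) - t ^ (n + 1) := by
  rw [Nat.sum_antidiagonal_eq_sum_range_succ (fun i j => s ^ i * t ^ j), ← geom_sum₂_mul, mul_comm]
  simp

lemma testFun_sub_testFun (n : ℕ) (s t : ℝ) :
    testFun n s - testFun n t = (s - t) * testQuot n s t := by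
  rw [testQuot, mul_sub, sub_mul_sum_antidiagonal, sub_mul_sum_antidiagonal, testFun, testFun]
  ring

lemma testQuot_comm (n : ℕ) (s t : ℝ) : testQuot n s t = testQuot n t s := by
  unfold testQuot
  congr 1 <;>
  · rw [← Nat.sum_antidiagonal_swap]
    exact sum_congr rfl fun ij _ => by simp [mul_comm]

lemma testQuot_self (n : ℕ) (t : ℝ) :
    testQuot n t t = (n + 1) * t ^ n - (n + 2) * t ^ (n + 1) := by
  have h : ∀ k : ℕ, ∑ ij ∈ antidiagonal k, t ^ ij.1 * t ^ ij.2 = (k + 1) * t ^ k := by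
    intro k
    rw [sum_congr rfl (g := fun _ => t ^ k) fun ij hij => by
      rw [← pow_add, mem_antidiagonal.1 hij]]
    simp
  rw [testQuot, h, h]
  push_cast
  ring

lemma sum_sum_testQuot (n : ℕ) {N : ℕ} (x : Fin N → ℝ) :
    ∑ i, ∑ j, testQuot n (x i) (x j) = loopTerm n x := by
  have h : ∀ k : ℕ, ∑ i, ∑ j, ∑ pq ∈ antidiagonal k, x i ^ pq.1 * x j ^ pq.2
      = selfConv (fun r => powerSum r x) k := by
    intro k
    simp only [selfConv, powerSum, sum_mul_sum]
    rw [sum_comm]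
    simp only [sum_comm (s := antidiagonal k)]
    rw [sum_comm]
  simp only [testQuot, sum_sub_distrib, h, loopTerm]

lemma sum_Ioi_two_mul_testQuot (n : ℕ) {N : ℕ} (x : Fin N → ℝ) :
    ∑ i, ∑ j ∈ Ioi i, 2 * testQuot n (x i) (x j)
      = loopTerm n x - ∑ i, testQuot n (x i) (x i) := by
  have h := sum_sum_Ioi_add_eq_sum_sum_off_diag fun i j => testQuot n (x i) (x j)
  rw [← sum_sum_testQuot, ← sum_sub_distrib]
  refine Eq.trans ?_ (h.trans ?_)
  · refine sum_congr rfl fun i _ => sum_congr rfl fun j _ => ?_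
    rw [testQuot_comm n (x j) (x i)]
    ring
  · refine sum_congr rfl fun i _ => ?_
    rw [← sum_compl_add_sum {i} fun j => testQuot n (x i) (x j), sum_singleton, add_sub_cancel_right]
    exact sum_congr rfl fun j _ => testQuot_comm _ _ _

lemma fderiv_prod_apply_of_log_deriv {E ι : Type*} [NormedAddCommGroup E] [NormedSpace ℝ E]
    {x v : E} (s : Finset ι) {f : ι → E → ℝ} {l : ι → ℝ}
    (hf : ∀ i ∈ s, DifferentiableAt ℝ (f i) x)
    (hl : ∀ i ∈ s, fderiv ℝ (f i) x v = f i x * l i) :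
    fderiv ℝ (fun y => ∏ i ∈ s, f i y) x v = (∏ i ∈ s, f i x) * ∑ i ∈ s, l i := by
  classical
  induction s using Finset.induction_on with
  | empty => simp
  | insert i s his ih =>
    have hs := ih (fun j hj => hf j (mem_insert_of_mem hj)) fun j hj => hl j (mem_insert_of_mem hj)
    have hd : DifferentiableAt ℝ (fun y => ∏ j ∈ s, f j y) x :=
      (HasFDerivAt.finsetProd fun j hj =>
        (hf j (mem_insert_of_mem hj)).hasFDerivAt).differentiableAt
    simp only [prod_insert his, sum_insert his]
    rw [fderiv_fun_mul (hf i (mem_insert_self _ _)) hd]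
    simp only [_root_.add_apply, _root_.smul_apply, smul_eq_mul, hs,
      hl i (mem_insert_self _ _)]
    ring

lemma hasFDerivAt_eval {N : ℕ} (i : Fin N) (x : Fin N → ℝ) :
    HasFDerivAt (fun y : Fin N → ℝ => y i) (ContinuousLinearMap.proj (R := ℝ) i) x :=
  hasFDerivAt_apply i x

lemma fderiv_vandermondeSq_apply (n : ℕ) {N : ℕ} (x : Fin N → ℝ) :
    fderiv ℝ vandermondeSq x (fun i => testFun n (x i))
      = vandermondeSq x * (loopTerm n x - ∑ i, testQuot n (x i) (x i)) := by
  rw [← sum_Ioi_two_mul_testQuot]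
  refine fderiv_prod_apply_of_log_deriv univ (fun i _ => by fun_prop) fun i _ => ?_
  refine fderiv_prod_apply_of_log_deriv (Ioi i) (fun j _ => by fun_prop) fun j _ => ?_
  have h : HasFDerivAt (fun y : Fin N → ℝ => (y i - y j) ^ 2) _ x :=
    ((hasFDerivAt_eval i x).fun_sub (hasFDerivAt_eval j x)).pow 2
  rw [h.fderiv]
  have := testFun_sub_testFun n (x i) (x j)
  simp [this]
  ring

lemma contDiff_vandermondeSq (N : ℕ) : ContDiff ℝ 1 (vandermondeSq : (Fin N → ℝ) → ℝ) := by
  unfold vandermondeSq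
  fun_prop

lemma contDiff_powerSum (r N : ℕ) : ContDiff ℝ 1 (powerSum r : (Fin N → ℝ) → ℝ) := by
  unfold powerSum
  fun_prop

lemma contDiff_selfConv_powerSum (n N : ℕ) :
    ContDiff ℝ 1 fun x : Fin N → ℝ => selfConv (fun r => powerSum r x) n :=
  ContDiff.sum fun ij _ => (contDiff_powerSum ij.1 N).mul (contDiff_powerSum ij.2 N)

lemma contDiff_loopTerm (n N : ℕ) : ContDiff ℝ 1 (loopTerm n : (Fin N → ℝ) → ℝ) :=
  (contDiff_selfConv_powerSum n N).sub (contDiff_selfConv_powerSum (n + 1) N)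

lemma abs_powerSum_le (r : ℕ) {N : ℕ} {x : Fin N → ℝ} (hx : x ∈ unitCube N) :
    |powerSum r x| ≤ N := by
  refine (abs_sum_le_sum_abs _ _).trans ?_
  refine (sum_le_card_nsmul univ _ 1 fun i _ => ?_).trans (by simp)
  have := hx i trivial
  rw [abs_of_nonneg (pow_nonneg this.1 _)]
  exact pow_le_one₀ this.1 this.2

lemma abs_fderiv_powerSum_apply_le (n r : ℕ) {N : ℕ} {x : Fin N → ℝ} (hx : x ∈ unitCube N) :
    |fderiv ℝ (powerSum r) x (fun i => testFun n (x i))| ≤ r * N := by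
  have h : HasFDerivAt (powerSum r : (Fin N → ℝ) → ℝ) _ x :=
    HasFDerivAt.fun_sum fun i (_ : i ∈ univ) => (hasFDerivAt_eval i x).pow r
  rw [h.fderiv]
  simp only [_root_.sum_apply, _root_.smul_apply,
    ContinuousLinearMap.proj_apply, smul_eq_mul]
  refine (abs_sum_le_sum_abs _ _).trans ?_
  refine (sum_le_card_nsmul univ _ (r : ℝ) fun i _ => ?_).trans (by simp [mul_comm])
  obtain ⟨h0, h1⟩ := hx i trivial
  have h2 : 0 ≤ 1 - x i := by linarith
  unfold testFun
  simp only [nsmul_eq_mul]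
  rw [abs_of_nonneg (by positivity), mul_assoc]
  refine mul_le_of_le_one_right (by positivity) (mul_le_one₀ (pow_le_one₀ h0 h1) (by positivity) ?_)
  exact mul_le_one₀ (pow_le_one₀ h0 h1) h2 (by linarith)

lemma abs_fderiv_selfConv_apply_le (n m : ℕ) {N : ℕ} {x : Fin N → ℝ} (hx : x ∈ unitCube N) :
    |fderiv ℝ (fun y : Fin N → ℝ => selfConv (fun r => powerSum r y) m) x
      (fun i => testFun n (x i))| ≤ (m + 1) * m * N ^ 2 := by
  have hd : ∀ r, DifferentiableAt ℝ (powerSum r : (Fin N → ℝ) → ℝ) x := fun r =>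
    (contDiff_powerSum r N).differentiable one_ne_zero x
  unfold selfConv
  rw [fderiv_fun_sum fun ij _ => (hd ij.1).fun_mul (hd ij.2), _root_.sum_apply]
  refine (abs_sum_le_sum_abs _ _).trans ?_
  refine (sum_le_card_nsmul _ _ ((m : ℝ) * N ^ 2) fun ij hij => ?_).trans
    (by simp [mul_assoc])
  rw [fderiv_fun_mul (hd ij.1) (hd ij.2)]
  simp only [_root_.add_apply, _root_.smul_apply, smul_eq_mul]
  refine (abs_add_le _ _).trans ?_
  rw [abs_mul, abs_mul, ← mem_antidiagonal.1 hij]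
  have h1 := mul_le_mul (abs_powerSum_le ij.1 hx) (abs_fderiv_powerSum_apply_le n ij.2 hx)
    (abs_nonneg _) (by positivity)
  have h2 := mul_le_mul (abs_powerSum_le ij.2 hx) (abs_fderiv_powerSum_apply_le n ij.1 hx)
    (abs_nonneg _) (by positivity)
  push_cast
  linarith

lemma abs_fderiv_loopTerm_apply_le (n : ℕ) {N : ℕ} {x : Fin N → ℝ} (hx : x ∈ unitCube N) :
    |fderiv ℝ (loopTerm n) x (fun i => testFun n (x i))| ≤ 2 * (n + 2) ^ 2 * N ^ 2 := by
  have e : fderiv ℝ (loopTerm n : (Fin N → ℝ) → ℝ) x = _ :=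
    fderiv_fun_sub ((contDiff_selfConv_powerSum n N).differentiable one_ne_zero x)
      ((contDiff_selfConv_powerSum (n + 1) N).differentiable one_ne_zero x)
  rw [e, _root_.sub_apply]
  refine (abs_sub _ _).trans ?_
  have h1 := abs_fderiv_selfConv_apply_le n n hx
  have h2 := abs_fderiv_selfConv_apply_le n (n + 1) hx
  push_cast at h2
  have h3 : (0 : ℝ) ≤ (2 * n + 6) * N ^ 2 := by positivity
  nlinarith

lemma abs_selfConv_powerSum_le (m : ℕ) {N : ℕ} {x : Fin N → ℝ} (hx : x ∈ unitCube N) :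
    |selfConv (fun r => powerSum r x) m| ≤ (m + 1) * N ^ 2 := by
  refine (abs_sum_le_sum_abs _ _).trans ?_
  refine (sum_le_card_nsmul _ _ ((N : ℝ) ^ 2) fun ij _ => ?_).trans (by simp)
  rw [abs_mul, sq]
  exact mul_le_mul (abs_powerSum_le _ hx) (abs_powerSum_le _ hx) (abs_nonneg _) (by positivity)

lemma abs_loopTerm_le (n : ℕ) {N : ℕ} {x : Fin N → ℝ} (hx : x ∈ unitCube N) :
    |loopTerm n x| ≤ 2 * (n + 2) * N ^ 2 := by
  refine (abs_sub _ _).trans ?_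
  have h1 := abs_selfConv_powerSum_le n hx
  have h2 := abs_selfConv_powerSum_le (n + 1) hx
  push_cast at h2
  nlinarith [sq_nonneg (N : ℝ)]

/-- The density of the Jacobi ensemble, up to normalisation. -/
noncomputable def jacobiDensity {N : ℕ} (a b : ℝ) (x : Fin N → ℝ) : ℝ :=
  vandermondeSq x * jacobiProdWeight a b x

lemma integrableOn_mul_jacobiDensity {N : ℕ} {a b : ℝ} (ha : 0 < a) (hb : 0 < b)
    {f : (Fin N → ℝ) → ℝ} (hf : Continuous f) :
    IntegrableOn (fun x => f x * jacobiDensity a b x) (unitCube N) := by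
  have h := integrableOn_mul_jacobiProdWeight ha hb (hf.mul (contDiff_vandermondeSq N).continuous)
  simpa only [jacobiDensity, Pi.mul_apply, ← mul_assoc] using h

/-- The subleading part of the `n`-th loop equation. -/
noncomputable def loopRemainder (n : ℕ) (a b : ℝ) {N : ℕ} (x : Fin N → ℝ) : ℝ :=
  (a - 1) * powerSum n x + (2 - a - b) * powerSum (n + 1) x

lemma sum_testDrift_sub_testQuot (n : ℕ) (a b : ℝ) {N : ℕ} (x : Fin N → ℝ) :
    ∑ i, testDrift n a b (x i) - ∑ i, testQuot n (x i) (x i) = loopRemainder n a b x := by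
  rw [loopRemainder, powerSum, powerSum, mul_sum, mul_sum, ← sum_sub_distrib, ← sum_add_distrib]
  refine sum_congr rfl fun i _ => ?_
  rw [testQuot_self, testDrift]
  ring

lemma integral_loop_equation (n : ℕ) {N : ℕ} {a b : ℝ} (ha : 0 < a) (hb : 0 < b) :
    ∫ x in unitCube N, (loopTerm n x ^ 2 + (fderiv ℝ (loopTerm n) x (fun i => testFun n (x i))
      + loopTerm n x * loopRemainder n a b x)) * jacobiDensity a b x = 0 := by
  have hV := contDiff_vandermondeSq N
  have hL := contDiff_loopTerm n N
  rw [← integral_fderiv_mul_jacobiProdWeight n ha hb (hL.mul hV)]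
  congr 1 with x
  rw [fderiv_fun_mul (hL.differentiable one_ne_zero x) (hV.differentiable one_ne_zero x)]
  simp only [_root_.add_apply, _root_.smul_apply, smul_eq_mul,
    fderiv_vandermondeSq_apply, ← sum_testDrift_sub_testQuot, jacobiDensity]
  ring

lemma jacobiWeight_nonneg {a b t : ℝ} (ht : t ∈ Set.Icc (0 : ℝ) 1) : 0 ≤ jacobiWeight a b t :=
  mul_nonneg (Real.rpow_nonneg ht.1 _) (Real.rpow_nonneg (by linarith [ht.2]) _)

lemma jacobiDensity_nonneg {N : ℕ} {a b : ℝ} {x : Fin N → ℝ} (hx : x ∈ unitCube N) :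
    0 ≤ jacobiDensity a b x :=
  mul_nonneg (prod_nonneg fun _ _ => prod_nonneg fun _ _ => sq_nonneg _)
    (prod_nonneg fun i _ => jacobiWeight_nonneg (hx i trivial))

lemma integral_jacobiDensity_pos (N : ℕ) {a b : ℝ} (ha : 0 < a) (hb : 0 < b) :
    0 < ∫ x in unitCube N, jacobiDensity a b x := by
  have hint : IntegrableOn (fun x : Fin N → ℝ => jacobiDensity a b x) (unitCube N) := by
    simpa using integrableOn_mul_jacobiDensity (N := N) ha hb (f := fun _ => 1) continuous_const
  have hnn : 0 ≤ᵐ[volume.restrict (unitCube N)] fun x : Fin N → ℝ => jacobiDensity a b x :=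
    ae_restrict_of_forall_mem (measurableSet_unitCube N) fun x hx => jacobiDensity_nonneg hx
  rw [setIntegral_pos_iff_support_of_nonneg_ae hnn hint]
  set U : Set (Fin N → ℝ) :=
    (Set.univ.pi fun _ => Set.Ioo (0 : ℝ) 1) ∩ {x | vandermondeSq x ≠ 0} with hU
  have hopen : IsOpen U :=
    (isOpen_set_pi Set.finite_univ fun _ _ => isOpen_Ioo).inter
      (isOpen_ne_fun (contDiff_vandermondeSq N).continuous continuous_const)
  have hne : U.Nonempty := by
    refine ⟨fun i => ((i : ℝ) + 1) / (N + 1), fun i _ => ⟨by positivity, ?_⟩, ?_⟩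
    · rw [div_lt_one (by positivity)]
      have : (i : ℝ) < N := by exact_mod_cast i.2
      linarith
    · refine prod_ne_zero_iff.2 fun i _ => prod_ne_zero_iff.2 fun j hj => pow_ne_zero 2 ?_
      have hij : (i : ℝ) < j := by exact_mod_cast mem_Ioi.1 hj
      rw [← sub_div]
      exact div_ne_zero (by linarith) (by positivity)
  refine (hopen.measure_pos volume hne).trans_le (measure_mono fun x hx => ⟨?_, fun i _ => ?_⟩)
  · refine mul_ne_zero hx.2 (prod_ne_zero_iff.2 fun i _ => ?_)
    obtain ⟨h0, h1⟩ := hx.1 i trivial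
    exact mul_ne_zero (Real.rpow_pos_of_pos h0 _).ne' (Real.rpow_pos_of_pos (by linarith) _).ne'
  · exact Set.Ioo_subset_Icc_self (hx.1 i trivial)

/-- Second moment bound for the leading term of the loop equation. -/
lemma exists_integral_loopTerm_sq_le (n : ℕ) {a b : ℝ} (ha : 0 < a) (hb : 0 < b) :
    ∃ C : ℝ, 0 ≤ C ∧ ∀ N : ℕ, ∫ x in unitCube N, loopTerm n x ^ 2 * jacobiDensity a b x
      ≤ C * N ^ 3 * ∫ x in unitCube N, jacobiDensity a b x := by
  set A := |a - 1| + |2 - a - b| with hA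
  refine ⟨2 * (n + 2) ^ 2 + 2 * (n + 2) * A, by positivity, fun N => ?_⟩
  have hL := contDiff_loopTerm n N
  have hLc := hL.continuous
  set rest : (Fin N → ℝ) → ℝ := fun x => fderiv ℝ (loopTerm n) x (fun i => testFun n (x i))
    + loopTerm n x * loopRemainder n a b x with hrest
  have hrc : Continuous rest := by
    have h1 : Continuous fun x : Fin N → ℝ =>
        fderiv ℝ (loopTerm n) x (fun i => testFun n (x i)) :=
      (hL.continuous_fderiv one_ne_zero).clm_apply (by unfold testFun; fun_prop)
    have h2 := (contDiff_powerSum n N).continuous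
    have h3 := (contDiff_powerSum (n + 1) N).continuous
    rw [hrest]
    unfold loopRemainder
    fun_prop
  have hloop := integral_loop_equation n (N := N) ha hb
  have hi1 := integrableOn_mul_jacobiDensity (N := N) ha hb (f := fun x => loopTerm n x ^ 2)
    (by fun_prop)
  have hi2 := integrableOn_mul_jacobiDensity ha hb hrc
  have hi3 := integrableOn_mul_jacobiDensity (N := N) ha hb
    (f := fun _ => (2 * (n + 2) ^ 2 + 2 * (n + 2) * A) * (N : ℝ) ^ 3) continuous_const
  have hsplit : ∫ x in unitCube N, loopTerm n x ^ 2 * jacobiDensity a b x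
      = ∫ x in unitCube N, -(rest x * jacobiDensity a b x) := by
    simp only [add_mul (loopTerm n _ ^ 2)] at hloop
    rw [integral_add hi1 hi2] at hloop
    rw [integral_neg]
    linarith
  rw [hsplit, ← integral_const_mul]
  refine setIntegral_mono_on hi2.neg hi3 (measurableSet_unitCube N) fun x hx => ?_
  rw [← neg_mul]
  refine mul_le_mul_of_nonneg_right ((neg_le_abs _).trans ?_) (jacobiDensity_nonneg hx)
  have hR : |loopRemainder n a b x| ≤ A * N := by
    refine (abs_add_le _ _).trans ?_
    rw [abs_mul, abs_mul, hA, add_mul]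
    exact add_le_add (mul_le_mul_of_nonneg_left (abs_powerSum_le _ hx) (abs_nonneg _))
      (mul_le_mul_of_nonneg_left (abs_powerSum_le _ hx) (abs_nonneg _))
  have hN : (N : ℝ) ^ 2 ≤ (N : ℝ) ^ 3 := by
    rcases N.eq_zero_or_pos with rfl | hN
    · simp
    · exact pow_le_pow_right₀ (by exact_mod_cast hN) (by norm_num)
  calc |rest x| ≤ 2 * (n + 2) ^ 2 * N ^ 2 + 2 * (n + 2) * N ^ 2 * (A * N) := by
        refine (abs_add_le _ _).trans (add_le_add (abs_fderiv_loopTerm_apply_le n hx) ?_)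
        rw [abs_mul]
        exact mul_le_mul (abs_loopTerm_le n hx) hR (abs_nonneg _) (by positivity)
    _ ≤ 2 * (n + 2) ^ 2 * N ^ 3 + 2 * (n + 2) * N ^ 2 * (A * N) := by gcongr
    _ = _ := by ring

/-- First moment bound for the leading term of the loop equation. -/
lemma exists_integral_abs_loopTerm_le (n : ℕ) {a b : ℝ} (ha : 0 < a) (hb : 0 < b) :
    ∃ C : ℝ, 0 ≤ C ∧ ∀ N : ℕ, 0 < N →
      ∫ x in unitCube N, |loopTerm n x| / N ^ 2 * jacobiDensity a b x
      ≤ C / √N * ∫ x in unitCube N, jacobiDensity a b x := by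
  obtain ⟨C, hC, h⟩ := exists_integral_loopTerm_sq_le n ha hb
  refine ⟨1 + C, by positivity, fun N hN => ?_⟩
  have hLc := (contDiff_loopTerm n N).continuous
  set s := √(N : ℝ) with hs
  have hs0 : 0 < s := Real.sqrt_pos.2 (by exact_mod_cast hN)
  have hsN : (N : ℝ) = s ^ 2 := (Real.sq_sqrt (Nat.cast_nonneg N)).symm
  have hi1 := integrableOn_mul_jacobiDensity (N := N) ha hb
    (f := fun x => |loopTerm n x| / N ^ 2) (by fun_prop)
  have hi2 := integrableOn_mul_jacobiDensity (N := N) ha hb (f := fun _ => 1 / s) continuous_const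
  have hi3 := integrableOn_mul_jacobiDensity (N := N) ha hb (f := fun x => loopTerm n x ^ 2)
    (by fun_prop)
  have hbound : ∫ x in unitCube N, |loopTerm n x| / N ^ 2 * jacobiDensity a b x
      ≤ ∫ x in unitCube N, (1 / s * jacobiDensity a b x
        + 1 / s ^ 7 * (loopTerm n x ^ 2 * jacobiDensity a b x)) := by
    refine setIntegral_mono_on hi1 (hi2.add (hi3.const_mul _)) (measurableSet_unitCube N)
      fun x hx => ?_
    rw [← mul_assoc, ← add_mul]
    refine mul_le_mul_of_nonneg_right ?_ (jacobiDensity_nonneg hx)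
    rw [hsN, ← sub_nonneg]
    have e : 1 / s + 1 / s ^ 7 * loopTerm n x ^ 2 - |loopTerm n x| / (s ^ 2) ^ 2
        = ((s ^ 3 - |loopTerm n x|) ^ 2 + s ^ 3 * |loopTerm n x|) / s ^ 7 := by
      rw [← sq_abs (loopTerm n x)]
      field_simp
      ring
    rw [e]
    positivity
  refine hbound.trans ?_
  rw [integral_add hi2 (hi3.const_mul _), integral_const_mul, integral_const_mul]
  have h' := mul_le_mul_of_nonneg_left (h N) (by positivity : 0 ≤ 1 / s ^ 7)
  refine (add_le_add le_rfl h').trans (le_of_eq ?_)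
  rw [hsN]
  field_simp

lemma exists_abs_integral_powerSum_sub_le (k : ℕ) {a b : ℝ} (ha : 0 < a) (hb : 0 < b) :
    ∃ C : ℝ, ∀ N : ℕ, 0 < N →
      |∫ x in unitCube N, (powerSum k x / N - arcsineMoment k) * jacobiDensity a b x|
      ≤ C / √N * ∫ x in unitCube N, jacobiDensity a b x := by
  obtain ⟨C, hC, hstab⟩ := exists_abs_sub_arcsineMoment_le k
  choose K hK hloop using fun n => exists_integral_abs_loopTerm_le n ha hb
  refine ⟨C * ∑ n ∈ range k, K n, fun N hN => ?_⟩
  have hN0 : (0 : ℝ) < N := by exact_mod_cast hN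
  have hpc := (contDiff_powerSum k N).continuous
  have hLc : ∀ n, Continuous (loopTerm n : (Fin N → ℝ) → ℝ) := fun n =>
    (contDiff_loopTerm n N).continuous
  have hi1 := integrableOn_mul_jacobiDensity (N := N) ha hb
    (f := fun x => |powerSum k x / N - arcsineMoment k|) (by fun_prop)
  have hi2 : ∀ n ∈ range k, IntegrableOn (fun x : Fin N → ℝ =>
      |loopTerm n x| / N ^ 2 * jacobiDensity a b x) (unitCube N) := fun n _ =>
    integrableOn_mul_jacobiDensity (N := N) ha hb (by have := hLc n; fun_prop)
  have hpoint : ∀ x ∈ unitCube N, |powerSum k x / N - arcsineMoment k|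
      ≤ C * ∑ n ∈ range k, |loopTerm n x| / N ^ 2 := by
    intro x hx
    have hconv : ∀ n, selfConv (fun r => powerSum r x / N) n
        = selfConv (fun r => powerSum r x) n / N ^ 2 := by
      intro n
      rw [selfConv, selfConv, sum_div]
      exact sum_congr rfl fun _ _ => by ring
    have h := hstab (fun r => powerSum r x / N) (by simp [powerSum, hN0.ne']) fun j => by
      rw [abs_div, abs_of_pos hN0, div_le_one hN0]
      exact abs_powerSum_le j hx
    simpa only [hconv, ← sub_div, abs_div, abs_of_nonneg (sq_nonneg (N : ℝ)), loopTerm] using h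
  calc |∫ x in unitCube N, (powerSum k x / N - arcsineMoment k) * jacobiDensity a b x|
      ≤ ∫ x in unitCube N, |(powerSum k x / N - arcsineMoment k) * jacobiDensity a b x| :=
        abs_integral_le_integral_abs
    _ = ∫ x in unitCube N, |powerSum k x / N - arcsineMoment k| * jacobiDensity a b x :=
        setIntegral_congr_fun (measurableSet_unitCube N) fun x hx => by
          simp only [abs_mul, abs_of_nonneg (jacobiDensity_nonneg (a := a) (b := b) hx)]
    _ ≤ ∫ x in unitCube N, C * ∑ n ∈ range k, |loopTerm n x| / N ^ 2 * jacobiDensity a b x := by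
        refine setIntegral_mono_on hi1 ((integrable_finsetSum _ hi2).const_mul C)
          (measurableSet_unitCube N) fun x hx => ?_
        rw [← sum_mul, ← mul_assoc]
        exact mul_le_mul_of_nonneg_right (hpoint x hx) (jacobiDensity_nonneg hx)
    _ = C * ∑ n ∈ range k, ∫ x in unitCube N, |loopTerm n x| / N ^ 2 * jacobiDensity a b x := by
        rw [integral_const_mul, integral_finsetSum _ hi2]
    _ ≤ C * ∑ n ∈ range k, K n / √N * ∫ x in unitCube N, jacobiDensity a b x :=
        mul_le_mul_of_nonneg_left (sum_le_sum fun n _ => hloop n N hN) hC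
    _ = _ := by
        rw [← sum_mul, ← sum_div]
        ring

lemma jacobiAvg_eq (N : ℕ) (a b : ℝ) (f : (Fin N → ℝ) → ℝ) :
    jacobiAvg N a b f
      = (N.factorial : ℝ)⁻¹ * ∫ x in unitCube N, f x * jacobiDensity a b x := by
  simp only [jacobiAvg, jacobiDensity, vandermondeSq, jacobiProdWeight, jacobiWeight, unitCube,
    mul_assoc]

lemma Ik_div_sub_arcsineMoment (k : ℕ) {N : ℕ} {a b : ℝ} (ha : 0 < a) (hb : 0 < b) :
    Ik k N a b / N - arcsineMoment k
      = (∫ x in unitCube N, (powerSum k x / N - arcsineMoment k) * jacobiDensity a b x)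
        / ∫ x in unitCube N, jacobiDensity a b x := by
  have hZ := (integral_jacobiDensity_pos N ha hb).ne'
  have hf : (N.factorial : ℝ)⁻¹ ≠ 0 := inv_ne_zero (by exact_mod_cast N.factorial_ne_zero)
  have hi1 := integrableOn_mul_jacobiDensity ha hb (contDiff_powerSum k N).continuous
  have hi2 := integrableOn_mul_jacobiDensity (N := N) ha hb (f := fun _ => arcsineMoment k)
    continuous_const
  have e : ∀ x : Fin N → ℝ, (powerSum k x / N - arcsineMoment k) * jacobiDensity a b x
      = powerSum k x * jacobiDensity a b x / N - arcsineMoment k * jacobiDensity a b x := by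
    intro x
    ring
  simp only [e]
  rw [integral_sub (hi1.div_const _) hi2, integral_const_mul, integral_div, Ik, jacobiAvg_eq,
    jacobiAvg_eq, mul_div_mul_left _ _ hf, sub_div, mul_div_cancel_right₀ _ hZ, div_right_comm]
  simp only [one_mul, powerSum]

theorem Ik_div_N_limit_central_binomial (k : ℕ) (hk : 1 ≤ k) (a b : ℝ)
    (ha : 0 < a) (hb : 0 < b) :
    Filter.Tendsto (fun N : ℕ => Ik k N a b / (N : ℝ)) Filter.atTop
      (nhds (((2 * k).choose k : ℝ) / 4 ^ k)) := by
  obtain ⟨C, hC⟩ := exists_abs_integral_powerSum_sub_le k ha hb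
  have hlim : ((2 * k).choose k : ℝ) / 4 ^ k = arcsineMoment k := by
    rw [arcsineMoment, Nat.centralBinom_eq_two_mul_choose]
  rw [hlim, ← tendsto_sub_nhds_zero_iff]
  have hzero : Filter.Tendsto (fun N : ℕ => C / √(N : ℝ)) Filter.atTop (nhds 0) :=
    (Real.tendsto_sqrt_atTop.comp tendsto_natCast_atTop_atTop).const_div_atTop C
  refine squeeze_zero_norm' ?_ hzero
  filter_upwards [Filter.eventually_gt_atTop 0] with N hN
  have hZ := integral_jacobiDensity_pos N ha hb
  rw [Ik_div_sub_arcsineMoment k ha hb, Real.norm_eq_abs, abs_div, abs_of_pos hZ, div_le_iff₀ hZ]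
  exact hC N hN
end

section
/- Let k ≥ 1 be a natural number, let ℓ ≥ 1 and a_0 > 0 be real numbers, and let b_1 := ℓ − 1 and b_0 be real numbers such that b_1·N + b_0 > 0 for every natural number N ≥ 1. Then, as N → ∞, I_k(N; a_0, b_1·N + b_0)/N converges to ( Σ_{i=0}^{k−1} ((k−i)/k) · binom(2k, i) · ℓ^i ) / (1+ℓ)^{2k−1}. -/
open Finset MeasureTheory

/-- The unnormalised beta density. -/
noncomputable def betaWeight (a b x : ℝ) : ℝ := x ^ (a - 1) * (1 - x) ^ (b - 1)

theorem integrableOn_betaWeight {a b : ℝ} (ha : 0 < a) (hb : 0 < b) :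
    IntegrableOn (betaWeight a b) (Set.Icc 0 1) := by
  have h := Complex.betaIntegral_convergent (u := a) (v := b) (by simpa) (by simpa)
  rw [intervalIntegrable_iff_integrableOn_Ioc_of_le (by simp)] at h
  rw [integrableOn_Icc_iff_integrableOn_Ioc]
  refine IntegrableOn.congr_fun h.re (fun x hx => ?_) measurableSet_Ioc
  have h1 : (0 : ℝ) ≤ 1 - x := by linarith [hx.2]
  have e : ((x : ℂ) ^ ((a : ℂ) - 1) * (1 - (x : ℂ)) ^ ((b : ℂ) - 1)) =
      ((betaWeight a b x : ℝ) : ℂ) := by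
    rw [betaWeight]
    push_cast
    rw [Complex.ofReal_cpow hx.1.le, Complex.ofReal_cpow h1]
    push_cast
    rfl
  simp only [e, RCLike.re_to_complex, Complex.ofReal_re]

theorem integral_betaWeight {a b : ℝ} (ha : 0 < a) (hb : 0 < b) :
    ∫ x in Set.Icc 0 1, betaWeight a b x = ProbabilityTheory.beta a b := by
  rw [ProbabilityTheory.beta_eq_betaIntegralReal a b ha hb, Complex.betaIntegral,
    intervalIntegral.integral_of_le (by norm_num), integral_Icc_eq_integral_Ioc,
    ← RCLike.re_to_complex, ← integral_re]
  · refine setIntegral_congr_fun measurableSet_Ioc fun x ⟨hx1, hx₂⟩ ↦ ?_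
    have h1 : (0 : ℝ) ≤ 1 - x := by linarith
    have e : ((x : ℂ) ^ ((a : ℂ) - 1) * (1 - (x : ℂ)) ^ ((b : ℂ) - 1)) =
        ((betaWeight a b x : ℝ) : ℂ) := by
      rw [betaWeight]
      push_cast
      rw [Complex.ofReal_cpow hx1.le, Complex.ofReal_cpow h1]
      push_cast
      rfl
    simp only [e, RCLike.re_to_complex, Complex.ofReal_re]
  · have h := Complex.betaIntegral_convergent (u := a) (v := b) (by simpa) (by simpa)
    rwa [intervalIntegrable_iff_integrableOn_Ioc_of_le (by simp), IntegrableOn] at h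

theorem pow_mul_betaWeight {a b x : ℝ} (hx : 0 < x) (n : ℕ) :
    x ^ n * betaWeight a b x = betaWeight (a + n) b x := by
  rw [betaWeight, betaWeight, ← mul_assoc, ← Real.rpow_natCast, ← Real.rpow_add hx]
  ring_nf

theorem integrableOn_pow_mul_betaWeight {a b : ℝ} (ha : 0 < a) (hb : 0 < b) (n : ℕ) :
    IntegrableOn (fun x => x ^ n * betaWeight a b x) (Set.Icc 0 1) := by
  have h : IntegrableOn (betaWeight (a + n) b) (Set.Icc 0 1) :=
    integrableOn_betaWeight (by positivity) hb
  rw [integrableOn_Icc_iff_integrableOn_Ioc] at h ⊢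
  exact h.congr_fun (fun x hx => (pow_mul_betaWeight hx.1 n).symm) measurableSet_Ioc

/-- The moments of the beta weight, as a ratio of rising factorials. -/
noncomputable def betaMoment (a b : ℝ) (n : ℕ) : ℝ :=
  ProbabilityTheory.beta a b * ((∏ m ∈ range n, (a + m)) / ∏ m ∈ range n, (a + b + m))

theorem Gamma_add_natCast {a : ℝ} (ha : 0 < a) (n : ℕ) :
    Real.Gamma (a + n) = (∏ m ∈ range n, (a + m)) * Real.Gamma a := by
  induction n with
  | zero => simp
  | succ n ih =>
    rw [prod_range_succ, Nat.cast_succ, ← add_assoc, Real.Gamma_add_one (by positivity), ih]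
    ring

theorem integral_pow_mul_betaWeight {a b : ℝ} (ha : 0 < a) (hb : 0 < b) (n : ℕ) :
    ∫ x in Set.Icc 0 1, x ^ n * betaWeight a b x = betaMoment a b n := by
  have e : ∫ x in Set.Icc 0 1, x ^ n * betaWeight a b x =
      ∫ x in Set.Icc 0 1, betaWeight (a + n) b x := by
    rw [integral_Icc_eq_integral_Ioc, integral_Icc_eq_integral_Ioc]
    exact setIntegral_congr_fun measurableSet_Ioc (fun x hx => pow_mul_betaWeight hx.1 n)
  have h1 := Real.Gamma_pos_of_pos (add_pos ha hb)
  have h2 : 0 < ∏ m ∈ range n, (a + b + m) := prod_pos fun m _ => by positivity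
  rw [e, integral_betaWeight (by positivity) hb, betaMoment, ProbabilityTheory.beta,
    ProbabilityTheory.beta, add_right_comm, Gamma_add_natCast ha,
    Gamma_add_natCast (add_pos ha hb)]
  field_simp

section Andreief

variable {ι : Type*} [Fintype ι] [DecidableEq ι]

theorem det_mul_det_mul_prod_eq_sum (f g : ι → ℝ → ℝ) (w : ℝ → ℝ) (x : ι → ℝ) :
    (Matrix.of fun i j => f i (x j)).det * (Matrix.of fun i j => g i (x j)).det * ∏ i, w (x i) =
      ∑ σ : Equiv.Perm ι, ∑ τ : Equiv.Perm ι,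
        ((Equiv.Perm.sign σ : ℤ) : ℝ) * ((Equiv.Perm.sign τ : ℤ) : ℝ) *
          ∏ i, (f (σ i) (x i) * g (τ i) (x i) * w (x i)) := by
  rw [Matrix.det_apply', Matrix.det_apply', sum_mul_sum, sum_mul]
  simp only [Matrix.of_apply, prod_mul_distrib, sum_mul]
  exact sum_congr rfl fun σ _ => sum_congr rfl fun τ _ => by ring

theorem integrable_det_mul_det_mul_prod {μ : Measure ℝ} [SigmaFinite μ] (f g : ι → ℝ → ℝ)
    (w : ℝ → ℝ) (h : ∀ i j, Integrable (fun x => f i x * g j x * w x) μ) :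
    Integrable (fun x : ι → ℝ => (Matrix.of fun i j => f i (x j)).det *
      (Matrix.of fun i j => g i (x j)).det * ∏ i, w (x i)) (Measure.pi fun _ => μ) := by
  simp only [det_mul_det_mul_prod_eq_sum]
  refine integrable_finsetSum _ fun σ _ => integrable_finsetSum _ fun τ _ => ?_
  exact (Integrable.fintype_prod
    (f := fun i x => f (σ i) x * g (τ i) x * w x) fun i => h _ _).const_mul _

/-- **Andréief's identity**. -/
theorem integral_det_mul_det_mul_prod {μ : Measure ℝ} [SigmaFinite μ] (f g : ι → ℝ → ℝ)
    (w : ℝ → ℝ) (h : ∀ i j, Integrable (fun x => f i x * g j x * w x) μ) :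
    ∫ x : ι → ℝ, (Matrix.of fun i j => f i (x j)).det *
      (Matrix.of fun i j => g i (x j)).det * ∏ i, w (x i) ∂(Measure.pi fun _ => μ) =
      (Fintype.card ι).factorial * (Matrix.of fun i j => ∫ x, f i x * g j x * w x ∂μ).det := by
  have hi : ∀ σ τ : Equiv.Perm ι, Integrable (fun x : ι → ℝ =>
      ((Equiv.Perm.sign σ : ℤ) : ℝ) * ((Equiv.Perm.sign τ : ℤ) : ℝ) *
          ∏ i, (f (σ i) (x i) * g (τ i) (x i) * w (x i))) (Measure.pi fun _ => μ) :=
    fun σ τ => (Integrable.fintype_prod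
      (f := fun i x => f (σ i) x * g (τ i) x * w x) fun i => h _ _).const_mul _
  simp only [det_mul_det_mul_prod_eq_sum]
  rw [integral_finsetSum _ fun σ _ => integrable_finsetSum _ fun τ _ => hi σ τ]
  simp only [integral_finsetSum _ fun τ _ => hi _ τ, integral_const_mul]
  rw [sum_comm]
  have key : ∀ τ : Equiv.Perm ι, ∑ σ : Equiv.Perm ι,
      ((Equiv.Perm.sign σ : ℤ) : ℝ) * ((Equiv.Perm.sign τ : ℤ) : ℝ) *
        ∫ x : ι → ℝ, ∏ i, (f (σ i) (x i) * g (τ i) (x i) * w (x i)) ∂(Measure.pi fun _ => μ) =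
      (Matrix.of fun i j => ∫ x, f i x * g j x * w x ∂μ).det := by
    intro τ
    have e := Matrix.det_permute' τ (Matrix.of fun i j => ∫ x, f i x * g j x * w x ∂μ)
    have s : (((Equiv.Perm.sign τ : ℤ) : ℝ)) * ((Equiv.Perm.sign τ : ℤ) : ℝ) = 1 := by
      exact_mod_cast Int.units_coe_mul_self _
    rw [← one_mul (Matrix.det _), ← s, mul_assoc, ← e, Matrix.det_apply', mul_sum]
    refine sum_congr rfl fun σ _ => ?_
    rw [integral_fintype_prod_eq_prod (f := fun i x => f (σ i) x * g (τ i) x * w x)]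
    simp only [Matrix.submatrix_apply, Matrix.of_apply, id]
    ring
  rw [sum_congr rfl fun τ _ => key τ]
  simp [Fintype.card_perm]

theorem sum_mul_det {R : Type*} [CommRing R] (A : Matrix ι ι R) (d : ι → R) :
    (∑ i, d i) * A.det = ∑ j, (Matrix.of fun i l => A i l * if i = j then d l else 1).det := by
  simp only [Matrix.det_apply', Matrix.of_apply, prod_mul_distrib]
  rw [sum_comm, mul_sum]
  refine sum_congr rfl fun σ _ => ?_
  have : ∀ j, ∏ i, (if σ i = j then d i else 1) = d (σ⁻¹ j) := by
    intro j
    rw [prod_eq_single (σ⁻¹ j)]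
    · simp
    · intro b _ hb
      rw [if_neg]
      rintro rfl
      simp at hb
    · simp
  simp only [this, ← mul_assoc, ← mul_sum]
  rw [Equiv.sum_comp σ⁻¹ d]
  ring

end Andreief

/-- The determinant of beta moments with prescribed row exponents. -/
noncomputable def betaMomentDet (N : ℕ) (a b : ℝ) (e : Fin N → ℕ) : ℝ :=
  (Matrix.of fun i j : Fin N => betaMoment a b (e i + j)).det

section Average

variable {N : ℕ} {a b : ℝ}

theorem integrable_pow_mul_pow_mul_betaWeight (ha : 0 < a) (hb : 0 < b) (e : Fin N → ℕ)
    (i j : Fin N) : Integrable (fun x : ℝ => x ^ e i * x ^ (j : ℕ) * betaWeight a b x)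
      (volume.restrict (Set.Icc 0 1)) := by
  simp only [← pow_add]
  exact integrableOn_pow_mul_betaWeight ha hb _

theorem integral_det_pow_mul_det_pow (ha : 0 < a) (hb : 0 < b) (e : Fin N → ℕ) :
    ∫ x : Fin N → ℝ, (Matrix.of fun i j => x j ^ e i).det *
      (Matrix.of fun i j : Fin N => x j ^ (i : ℕ)).det * ∏ i, betaWeight a b (x i)
      ∂(Measure.pi fun _ => volume.restrict (Set.Icc 0 1)) =
      N.factorial * betaMomentDet N a b e := by
  rw [integral_det_mul_det_mul_prod (fun i x => x ^ e i) (fun i x => x ^ (i : ℕ)) _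
    (integrable_pow_mul_pow_mul_betaWeight ha hb e), Fintype.card_fin, betaMomentDet]
  simp only [← pow_add, integral_pow_mul_betaWeight ha hb]

theorem prod_prod_Ioi_sub_sq (x : Fin N → ℝ) :
    ∏ i, ∏ j ∈ Ioi i, (x i - x j) ^ 2 =
      (Matrix.of fun i j : Fin N => x j ^ (i : ℕ)).det *
        (Matrix.of fun i j : Fin N => x j ^ (i : ℕ)).det := by
  have h : (Matrix.of fun i j : Fin N => x j ^ (i : ℕ)) = (Matrix.vandermonde x).transpose := by
    ext i j
    rfl
  rw [h, Matrix.det_transpose, Matrix.det_vandermonde, ← prod_mul_distrib]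
  refine prod_congr rfl fun i _ => ?_
  rw [← prod_mul_distrib]
  exact prod_congr rfl fun j _ => by ring

theorem volume_restrict_pi_Icc : (volume : Measure (Fin N → ℝ)).restrict
    (Set.univ.pi fun _ => Set.Icc (0 : ℝ) 1) =
      Measure.pi fun _ => volume.restrict (Set.Icc 0 1) := by
  rw [volume_pi, Measure.restrict_pi_pi]

theorem jacobiAvg_one (ha : 0 < a) (hb : 0 < b) :
    jacobiAvg N a b (fun _ => 1) = betaMomentDet N a b (fun i => i) := by
  have h := integral_det_pow_mul_det_pow ha hb (fun i : Fin N => (i : ℕ))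
  simp only [jacobiAvg, volume_restrict_pi_Icc, one_mul, prod_prod_Ioi_sub_sq]
  simp only [betaWeight] at h
  rw [h, inv_mul_cancel_left₀ (by positivity)]

theorem jacobiAvg_sum_pow (ha : 0 < a) (hb : 0 < b) (k : ℕ) :
    jacobiAvg N a b (fun x => ∑ i, x i ^ k) =
      ∑ j : Fin N, betaMomentDet N a b (fun i => i + if i = j then k else 0) := by
  have e : ∀ x : Fin N → ℝ, (∑ i, x i ^ k) * (∏ i, ∏ j ∈ Ioi i, (x i - x j) ^ 2) *
      ∏ i, x i ^ (a - 1) * (1 - x i) ^ (b - 1) =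
      ∑ l : Fin N, (Matrix.of fun i j : Fin N => x j ^ ((i : ℕ) + if i = l then k else 0)).det *
      (Matrix.of fun i j : Fin N => x j ^ (i : ℕ)).det * ∏ i, betaWeight a b (x i) := by
    intro x
    rw [prod_prod_Ioi_sub_sq, ← mul_assoc, sum_mul_det, ← sum_mul, ← sum_mul]
    congr 2
    refine sum_congr rfl fun l _ => ?_
    congr 1
    ext i j
    simp only [Matrix.of_apply, pow_add]
    split_ifs <;> simp
  simp only [jacobiAvg, volume_restrict_pi_Icc, e]
  rw [integral_finsetSum]
  · rw [sum_congr rfl fun l _ => integral_det_pow_mul_det_pow ha hb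
        (fun i : Fin N => (i : ℕ) + if i = l then k else 0), ← mul_sum, inv_mul_cancel_left₀ (by positivity)]
  · intro l _
    exact integrable_det_mul_det_mul_prod
      (fun (i : Fin N) x => x ^ ((i : ℕ) + if i = l then k else 0)) (fun i x => x ^ (i : ℕ)) _
      (integrable_pow_mul_pow_mul_betaWeight ha hb _)

end Average

section Interpolation

open Polynomial

variable {N : ℕ}

theorem eval_eq_sum_eval_lagrangeBasis {q : ℝ[X]} (hq : q.degree < N) (y : ℝ) :
    q.eval y = ∑ i : Fin N,
      (Lagrange.basis univ (fun i : Fin N => ((i : ℕ) : ℝ)) i).eval y * q.eval ((i : ℕ) : ℝ) := by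
  have hinj : Set.InjOn (fun i : Fin N => ((i : ℕ) : ℝ)) (univ : Finset (Fin N)) :=
    fun i _ j _ h => Fin.ext (Nat.cast_injective h)
  have h := Lagrange.eq_interpolate hinj (f := q) (by simpa using hq)
  conv_lhs => rw [h, Lagrange.interpolate_apply, eval_finsetSum]
  simp [mul_comm]

/-- The polynomials by which the beta moments in a row are proportional. -/
noncomputable def betaRowPoly (N : ℕ) (a b : ℝ) (i : ℕ) : ℝ[X] :=
  (∏ m ∈ range i, (X + C (a + m))) * ∏ m ∈ Ico i (N - 1), (X + C (a + b + m))

theorem degree_betaRowPoly_lt (a b : ℝ) (i : Fin N) : (betaRowPoly N a b i).degree < N := by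
  have hi := i.isLt
  rw [betaRowPoly, degree_mul, degree_prod, degree_prod]
  simp only [degree_X_add_C, sum_const, card_range, Nat.card_Ico, nsmul_eq_mul, mul_one]
  exact_mod_cast (by omega : (i : ℕ) + (N - 1 - i) < N)

theorem eval_betaRowPoly (a b y : ℝ) (i : ℕ) : (betaRowPoly N a b i).eval y =
    (∏ m ∈ range i, (y + a + m)) * ∏ m ∈ Ico i (N - 1), (y + a + b + m) := by
  simp [betaRowPoly, eval_prod, add_assoc]

/-- The row prefactor of the beta moments. -/
noncomputable def betaRowFactor (N : ℕ) (a b : ℝ) (n : ℕ) : ℝ :=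
  ProbabilityTheory.beta a b * (∏ m ∈ range n, (a + m)) / ∏ m ∈ range (n + (N - 1)), (a + b + m)

theorem betaRowFactor_pos {a b : ℝ} (ha : 0 < a) (hb : 0 < b) (n : ℕ) :
    0 < betaRowFactor N a b n :=
  div_pos (mul_pos (ProbabilityTheory.beta_pos ha hb) (prod_pos fun _ _ => by positivity))
    (prod_pos fun _ _ => by positivity)

theorem betaMoment_add {a b : ℝ} (ha : 0 < a) (hb : 0 < b) (n : ℕ) (i : Fin N) :
    betaMoment a b (n + i) = betaRowFactor N a b n * (betaRowPoly N a b i).eval (n : ℝ) := by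
  have hi : n + (i : ℕ) ≤ n + (N - 1) := by have := i.isLt; omega
  have e : ∏ m ∈ range (n + (N - 1)), (a + b + m) =
      (∏ m ∈ range (n + i), (a + b + m)) * ∏ m ∈ Ico (i : ℕ) (N - 1), ((n : ℝ) + a + b + m) := by
    rw [← prod_range_mul_prod_Ico _ hi]
    congr 1
    rw [add_comm n i, add_comm n (N - 1), ← prod_Ico_add']
    refine prod_congr rfl fun m _ => ?_
    push_cast
    ring
  have h1 : 0 < ∏ m ∈ range (n + i), (a + b + m) := prod_pos fun _ _ => by positivity
  have h2 : 0 < ∏ m ∈ Ico (i : ℕ) (N - 1), ((n : ℝ) + a + b + m) :=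
    prod_pos fun _ _ => by positivity
  rw [betaMoment, betaRowFactor, eval_betaRowPoly, e, prod_range_add]
  simp only [Nat.cast_add]
  have e2 : ∀ m : ℕ, a + ((n : ℝ) + m) = n + a + m := fun m => by ring
  simp only [e2]
  field_simp

theorem det_eval_betaRowPoly_ne_zero {a b : ℝ} (hb : 0 < b) :
    (Matrix.of fun i l : Fin N => (betaRowPoly N a b l).eval ((i : ℕ) : ℝ)).det ≠ 0 := by
  set Q := Matrix.of fun i l : Fin N => (betaRowPoly N a b l).eval ((i : ℕ) : ℝ)
  set T := Matrix.of fun i l : Fin N => (betaRowPoly N a b l).eval (-a - ((i : ℕ) : ℝ)) with hT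
  have h : T = (Matrix.of fun i l : Fin N =>
      (Lagrange.basis univ (fun i : Fin N => ((i : ℕ) : ℝ)) l).eval (-a - ((i : ℕ) : ℝ))) * Q := by
    ext i l
    simp only [T, Q, Matrix.mul_apply, Matrix.of_apply]
    exact eval_eq_sum_eval_lagrangeBasis (degree_betaRowPoly_lt a b l) _
  have hlt : T.BlockTriangular OrderDual.toDual := by
    intro i l hil
    have hil' : i < l := hil
    rw [hT, Matrix.of_apply, eval_betaRowPoly]
    refine mul_eq_zero_of_left (prod_eq_zero (i := (i : ℕ)) (by simpa using hil') ?_) _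
    ring
  have hd : T.det ≠ 0 := by
    rw [Matrix.det_of_isLowerTriangular _ hlt, prod_ne_zero_iff]
    intro i _
    rw [hT, Matrix.of_apply, eval_betaRowPoly]
    refine mul_ne_zero (prod_ne_zero_iff.2 fun m hm => ?_) (prod_ne_zero_iff.2 fun m hm => ?_)
    · have : (m : ℝ) < (i : ℕ) := by exact_mod_cast mem_range.1 hm
      linarith
    · have : ((i : ℕ) : ℝ) ≤ m := by exact_mod_cast (mem_Ico.1 hm).1
      linarith
  rw [h, Matrix.det_mul] at hd
  exact right_ne_zero_of_mul hd

theorem betaMomentDet_eq {a b : ℝ} (ha : 0 < a) (hb : 0 < b) (e : Fin N → ℕ) :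
    betaMomentDet N a b e = (∏ i, betaRowFactor N a b (e i)) *
      (Matrix.of fun i l : Fin N => (betaRowPoly N a b l).eval (e i : ℝ)).det := by
  rw [← Matrix.det_mul_column, betaMomentDet]
  simp only [betaMoment_add ha hb, Matrix.of_apply]

theorem betaMomentDet_ne_zero {a b : ℝ} (ha : 0 < a) (hb : 0 < b) :
    betaMomentDet N a b (fun i => i) ≠ 0 := by
  rw [betaMomentDet_eq ha hb]
  exact mul_ne_zero (prod_ne_zero_iff.2 fun i _ => (betaRowFactor_pos ha hb _).ne')
    (det_eval_betaRowPoly_ne_zero hb)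

theorem betaMomentDet_shift {a b : ℝ} (ha : 0 < a) (hb : 0 < b) (k : ℕ) (j : Fin N) :
    betaMomentDet N a b (fun i => i + if i = j then k else 0) =
      betaRowFactor N a b (j + k) / betaRowFactor N a b j *
        (∏ i ∈ (range N).erase j, (((j : ℕ) : ℝ) + k - i) / (((j : ℕ) : ℝ) - i)) *
        betaMomentDet N a b (fun i => i) := by
  rw [betaMomentDet_eq ha hb, betaMomentDet_eq ha hb]
  set Q := Matrix.of fun i l : Fin N => (betaRowPoly N a b l).eval ((i : ℕ) : ℝ) with hQ
  have hrow : (Matrix.of fun i l : Fin N => (betaRowPoly N a b l).eval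
      ((((i : ℕ) + if i = j then k else 0 : ℕ)) : ℝ)) =
      Q.updateRow j (∑ i : Fin N, (Lagrange.basis univ (fun i : Fin N => ((i : ℕ) : ℝ)) i).eval
        (((j : ℕ) : ℝ) + k) • Q i) := by
    ext i l
    by_cases hij : i = j
    · subst hij
      rw [Matrix.updateRow_self, Matrix.of_apply, if_pos rfl, Nat.cast_add,
        eval_eq_sum_eval_lagrangeBasis (degree_betaRowPoly_lt a b l)]
      simp [hQ]
    · simp [hij, hQ]
  have hc : (Lagrange.basis univ (fun i : Fin N => ((i : ℕ) : ℝ)) j).eval (((j : ℕ) : ℝ) + k) =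
      ∏ i ∈ (range N).erase j, (((j : ℕ) : ℝ) + k - i) / (((j : ℕ) : ℝ) - i) := by
    have himg : (range N).erase (j : ℕ) = (univ.erase j).map Fin.valEmbedding := by
      simp [map_erase, Nat.Iio_eq_range]
    rw [Lagrange.basis, eval_prod, himg, prod_map]
    refine prod_congr rfl fun i _ => ?_
    simp [Lagrange.basisDivisor, div_eq_inv_mul]
  have hp : (∏ i : Fin N, betaRowFactor N a b (i + if i = j then k else 0)) =
      betaRowFactor N a b (j + k) / betaRowFactor N a b j *
        ∏ i : Fin N, betaRowFactor N a b i := by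
    rw [← mul_prod_erase univ _ (mem_univ j),
      ← mul_prod_erase univ (fun i : Fin N => betaRowFactor N a b i) (mem_univ j), if_pos rfl,
      prod_congr rfl fun i hi => by rw [if_neg (ne_of_mem_erase hi), add_zero]]
    have := (betaRowFactor_pos (N := N) ha hb j).ne'
    field_simp
  rw [hrow, Matrix.det_updateRow_sum, hc, hp, smul_eq_mul]
  ring

end Interpolation

theorem Ik_eq_sum_range {N : ℕ} {a b : ℝ} (ha : 0 < a) (hb : 0 < b) (k : ℕ) :
    Ik k N a b = ∑ j ∈ range N, betaRowFactor N a b (j + k) / betaRowFactor N a b j *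
        ∏ i ∈ (range N).erase j, ((j : ℝ) + k - i) / ((j : ℝ) - i) := by
  rw [Ik, jacobiAvg_one ha hb, jacobiAvg_sum_pow ha hb,
    sum_congr rfl fun j _ => betaMomentDet_shift ha hb k j, ← sum_mul,
    mul_div_cancel_right₀ _ (betaMomentDet_ne_zero ha hb), ← Fin.sum_univ_eq_sum_range
    (fun j => betaRowFactor N a b (j + k) / betaRowFactor N a b j *
        ∏ i ∈ (range N).erase j, ((j : ℝ) + k - i) / ((j : ℝ) - i))]

theorem betaRowFactor_div {N : ℕ} {a b : ℝ} (ha : 0 < a) (hb : 0 < b) (j k : ℕ) :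
    betaRowFactor N a b (j + k) / betaRowFactor N a b j =
      ∏ m ∈ range k, (a + j + m) / (a + b + j + (N - 1 : ℕ) + m) := by
  rw [betaRowFactor, betaRowFactor, add_right_comm j k, prod_range_add, prod_range_add,
    prod_div_distrib]
  have h0 := ProbabilityTheory.beta_pos ha hb
  have h1 : 0 < ∏ m ∈ range j, (a + m) := prod_pos fun _ _ => by positivity
  have h2 : 0 < ∏ m ∈ range (j + (N - 1)), (a + b + m) := prod_pos fun _ _ => by positivity
  have h3 : 0 < ∏ m ∈ range k, (a + b + (j + (N - 1) + m : ℕ)) :=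
    prod_pos fun _ _ => by positivity
  have e : ∏ m ∈ range k, (a + b + j + (N - 1 : ℕ) + m) =
      ∏ m ∈ range k, (a + b + (j + (N - 1) + m : ℕ)) :=
    prod_congr rfl fun m _ => by push_cast; ring
  have e' : ∏ m ∈ range k, (a + j + m) = ∏ m ∈ range k, (a + (j + m : ℕ)) :=
    prod_congr rfl fun m _ => by push_cast; ring
  rw [e, e']
  field_simp

theorem prod_range_add_sub_div_sub (j k : ℕ) :
    ∏ i ∈ range j, ((j : ℝ) + k - i) / ((j : ℝ) - i) =
      (∏ m ∈ range k, ((j : ℝ) + 1 + m)) / k.factorial := by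
  have h : ∏ i ∈ range j, ((j : ℝ) + k - i) / ((j : ℝ) - i) =
      ∏ t ∈ range j, ((t : ℝ) + 1 + k) / (t + 1) := by
    rw [← prod_range_reflect]
    refine prod_congr rfl fun i hi => ?_
    have hi' : i + 1 ≤ j := mem_range.1 hi
    have e : ((j - 1 - i : ℕ) : ℝ) = j - (i + 1) := by
      rw [Nat.sub_sub, add_comm 1 i, Nat.cast_sub hi']
      push_cast
      ring
    rw [e]
    congr 1 <;> ring
  rw [h]
  clear h
  induction j with
  | zero =>
    have : (k.factorial : ℝ) ≠ 0 := by positivity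
    rw [prod_range_zero, eq_div_iff this, one_mul, ← prod_range_add_one_eq_factorial]
    push_cast
    exact prod_congr rfl fun m _ => by ring
  | succ j ih =>
    have e : (∏ m ∈ range k, ((j : ℝ) + 1 + m)) * (j + 1 + k) =
        (∏ m ∈ range k, (((j + 1 : ℕ) : ℝ) + 1 + m)) * (j + 1) := by
      rw [← prod_range_succ (fun m : ℕ => (j : ℝ) + 1 + m), prod_range_succ']
      push_cast
      rw [add_zero]
      congr 1
      exact prod_congr rfl fun m _ => by ring
    have : (0 : ℝ) < j + 1 := by positivity
    rw [prod_range_succ, ih]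
    field_simp
    linarith

theorem prod_range_sub_div_neg (n r : ℕ) :
    ∏ t ∈ range r, ((n : ℝ) - t) / (-(1 + t)) = (-1) ^ r * n.choose r := by
  induction r with
  | zero => simp
  | succ r ih =>
    have h : ((n.choose (r + 1) : ℕ) : ℝ) * (r + 1) = n.choose r * (n - r) := by
      rcases le_or_gt r n with hr | hr
      · have := Nat.choose_succ_right_eq n r
        rw [← Nat.cast_sub hr]
        exact_mod_cast this
      · simp [Nat.choose_eq_zero_of_lt hr, Nat.choose_eq_zero_of_lt (hr.trans (Nat.lt_succ_self r))]
    have h1 : (0 : ℝ) < 1 + r := by positivity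
    rw [prod_range_succ, ih]
    field_simp
    rw [pow_succ]
    linear_combination ((-1) ^ r) * h

theorem prod_erase_range_div (n j r : ℕ) :
    ∏ i ∈ (range (j + 1 + r)).erase j, ((j : ℝ) + (n + 1 : ℕ) - i) / ((j : ℝ) - i) =
      (-1) ^ r * n.choose r * (∏ m ∈ range (n + 1), ((j : ℝ) + 1 + m)) / (n + 1).factorial := by
  have e : ∏ i ∈ (range (j + 1 + r)).erase j, ((j : ℝ) + (n + 1 : ℕ) - i) / ((j : ℝ) - i) =
      ∏ i ∈ range (j + 1 + r),
        if i = j then 1 else ((j : ℝ) + (n + 1 : ℕ) - i) / ((j : ℝ) - i) := by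
    rw [← prod_erase (range (j + 1 + r)) (a := j) (f := fun i : ℕ =>
      if i = j then 1 else ((j : ℝ) + (n + 1 : ℕ) - i) / ((j : ℝ) - i)) (if_pos rfl)]
    exact prod_congr rfl fun i hi => (if_neg (ne_of_mem_erase hi)).symm
  rw [e, prod_range_add, prod_range_succ, if_pos rfl, mul_one,
    prod_congr rfl fun i hi => if_neg (mem_range.1 hi).ne, prod_range_add_sub_div_sub,
    mul_div_assoc, ← prod_range_sub_div_neg, mul_comm]
  congr 1
  refine prod_congr rfl fun t _ => ?_
  rw [if_neg (by omega)]
  push_cast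
  congr 1 <;> ring

theorem Ik_eq_alternating_sum {N n : ℕ} {a b : ℝ} (ha : 0 < a) (hb : 0 < b) (hN : n + 1 ≤ N) :
    Ik (n + 1) N a b = (((n + 1).factorial : ℝ))⁻¹ * ∑ r ∈ range (n + 1), (-1) ^ r * n.choose r *
      ∏ m ∈ range (n + 1), ((N : ℝ) - r + m) * (N - 1 - r + a + m) /
        (a + b + 2 * N - 2 - r + m) := by
  rw [Ik_eq_sum_range ha hb, ← sum_range_reflect, mul_sum]
  have hsub : range (n + 1) ⊆ range N := range_subset_range.2 hN
  rw [← sum_subset hsub]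
  · refine sum_congr rfl fun r hr => ?_
    have hr' : r < n + 1 := mem_range.1 hr
    obtain ⟨j, rfl⟩ : ∃ j, N = j + 1 + r := ⟨N - 1 - r, by omega⟩
    have hj : j + 1 + r - 1 - r = j := by omega
    have hj' : j + 1 + r - 1 = j + r := by omega
    rw [hj, prod_erase_range_div, betaRowFactor_div ha hb, hj']
    have e : ∏ m ∈ range (n + 1), (((j + 1 + r : ℕ) : ℝ) - r + m) *
        ((j + 1 + r : ℕ) - 1 - r + a + m) / (a + b + 2 * (j + 1 + r : ℕ) - 2 - r + m) =
        (∏ m ∈ range (n + 1), ((j : ℝ) + 1 + m)) *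
          ∏ m ∈ range (n + 1), (a + j + m) / (a + b + j + (j + r : ℕ) + m) := by
      rw [← prod_mul_distrib]
      refine prod_congr rfl fun m _ => ?_
      rw [mul_div_assoc]
      push_cast
      congr 1
      · ring
      · congr 1 <;> ring
    rw [e]
    ring
  · intro r hrN hr
    have h1 : r < N := mem_range.1 hrN
    have h2 : n + 1 ≤ r := by simpa using hr
    refine mul_eq_zero_of_right _ (prod_eq_zero (i := N - 1 - r + (n + 1)) ?_ ?_)
    · rw [mem_erase, mem_range]
      omega
    · push_cast
      simp

section Jet

open Filter PowerSeries

/-- `HasScaledJet n f φ` says that for `j ≤ n` the `j`-th unit-step difference of `f N`, multiplied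
by `N ^ j`, tends to `j! • coeff j φ` at every point as `N → ∞`. -/
def HasScaledJet : ℕ → (ℕ → ℝ → ℝ) → PowerSeries ℝ → Prop
  | 0, f, φ => ∀ s, Tendsto (fun N => f N s) atTop (nhds (constantCoeff φ))
  | n + 1, f, φ => (∀ s, Tendsto (fun N => f N s) atTop (nhds (constantCoeff φ))) ∧
      HasScaledJet n (fun N s => N * (f N (s + 1) - f N s)) (derivative ℝ φ)

namespace HasScaledJet

variable {n : ℕ} {f g : ℕ → ℝ → ℝ} {φ ψ : PowerSeries ℝ}

theorem tendsto (h : HasScaledJet n f φ) (s : ℝ) :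
    Tendsto (fun N => f N s) atTop (nhds (constantCoeff φ)) := by
  cases n with
  | zero => exact h s
  | succ n => exact h.1 s

theorem congr (h : HasScaledJet n f φ) (hfg : ∀ s, ∀ᶠ N in atTop, f N s = g N s) :
    HasScaledJet n g φ := by
  induction n generalizing f g φ with
  | zero => exact fun s => (h s).congr' (hfg s)
  | succ n ih =>
    refine ⟨fun s => (h.1 s).congr' (hfg s), ih h.2 fun s => ?_⟩
    filter_upwards [hfg s, hfg (s + 1)] with N h1 h2
    rw [h1, h2]

theorem of_succ (h : HasScaledJet (n + 1) f φ) : HasScaledJet n f φ := by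
  induction n generalizing f φ with
  | zero => exact h.1
  | succ n ih => exact ⟨h.1, ih h.2⟩

theorem shift (h : HasScaledJet n f φ) : HasScaledJet n (fun N s => f N (s + 1)) φ := by
  induction n generalizing f φ with
  | zero => exact fun s => h (s + 1)
  | succ n ih => exact ⟨fun s => h.1 (s + 1), ih h.2⟩

theorem add (hf : HasScaledJet n f φ) (hg : HasScaledJet n g ψ) :
    HasScaledJet n (fun N s => f N s + g N s) (φ + ψ) := by
  induction n generalizing f g φ ψ with
  | zero =>
    intro s
    rw [map_add]
    exact (hf s).add (hg s)
  | succ n ih =>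
    refine ⟨fun s => ?_, ?_⟩
    · rw [map_add]
      exact (hf.1 s).add (hg.1 s)
    · rw [map_add]
      exact (ih hf.2 hg.2).congr fun s => Eventually.of_forall fun N => by ring

theorem mul (hf : HasScaledJet n f φ) (hg : HasScaledJet n g ψ) :
    HasScaledJet n (fun N s => f N s * g N s) (φ * ψ) := by
  induction n generalizing f g φ ψ with
  | zero =>
    intro s
    rw [map_mul]
    exact (hf s).mul (hg s)
  | succ n ih =>
    refine ⟨fun s => ?_, ?_⟩
    · rw [map_mul]
      exact (hf.1 s).mul (hg.1 s)
    · rw [Derivation.leibniz, smul_eq_mul, smul_eq_mul]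
      exact ((ih hf.of_succ hg.2).add (ih hg.of_succ.shift hf.2)).congr
        fun s => Eventually.of_forall fun N => by ring

theorem const (c : ℝ) : HasScaledJet n (fun _ _ => c) (C c) := by
  induction n generalizing c with
  | zero =>
    intro s
    simp
  | succ n ih =>
    refine ⟨fun s => by simp, ?_⟩
    rw [derivative_C, ← map_zero C]
    exact (ih 0).congr fun s => Eventually.of_forall fun N => by ring

theorem tendsto_affine (c d s : ℝ) :
    Tendsto (fun N : ℕ => c + (s + d) / N) atTop (nhds c) := by
  simpa using (tendsto_const_div_atTop_nhds_zero_nat (s + d)).const_add c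

theorem affine (c d : ℝ) : HasScaledJet n (fun N s => c + (s + d) / N) (C c + X) := by
  have h : ∀ s, Tendsto (fun N : ℕ => c + (s + d) / N) atTop
      (nhds (constantCoeff (C c + X : PowerSeries ℝ))) := by
    intro s
    simpa using tendsto_affine c d s
  cases n with
  | zero => exact h
  | succ n =>
    refine ⟨h, ?_⟩
    rw [map_add, derivative_C, derivative_X, zero_add, ← map_one C]
    refine (const 1).congr fun s => ?_
    filter_upwards [eventually_gt_atTop 0] with N hN
    have : (0 : ℝ) < N := by exact_mod_cast hN
    field_simp
    ring

theorem affine_inv {c : ℝ} (hc : c ≠ 0) (d : ℝ) :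
    HasScaledJet n (fun N s => (c + (s + d) / N)⁻¹) (C c + X)⁻¹ := by
  have h : ∀ s, Tendsto (fun N : ℕ => (c + (s + d) / N)⁻¹) atTop
      (nhds (constantCoeff ((C c + X)⁻¹ : PowerSeries ℝ))) := by
    intro s
    simpa using (tendsto_affine c d s).inv₀ hc
  induction n with
  | zero => exact h
  | succ n ih =>
    refine ⟨h, ?_⟩
    have e : derivative ℝ ((C c + X)⁻¹ : PowerSeries ℝ) =
        C (-1) * ((C c + X)⁻¹ * (C c + X)⁻¹) := by
      rw [derivative_inv', map_add, derivative_C, derivative_X, map_neg, map_one]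
      ring
    rw [e]
    refine ((const (-1)).mul (ih.mul ih.shift)).congr fun s => ?_
    filter_upwards [eventually_gt_atTop 0, (tendsto_affine c d s).eventually_ne hc,
      (tendsto_affine c d (s + 1)).eventually_ne hc] with N hN h1 h2
    have h0 : (N : ℝ) ≠ 0 := by exact_mod_cast hN.ne'
    rw [inv_sub_inv h2 h1]
    field_simp
    ring

theorem prod_range {F : ℕ → ℕ → ℝ → ℝ} (h : ∀ m, HasScaledJet n (F m) φ) (k : ℕ) :
    HasScaledJet n (fun N s => ∏ m ∈ range k, F m N s) (φ ^ k) := by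
  induction k with
  | zero => simpa using const (n := n) 1
  | succ k ih =>
    simp only [prod_range_succ, pow_succ]
    exact ih.mul (h k)

theorem tendsto_fwdDiff (h : HasScaledJet n f φ) (s : ℝ) :
    Tendsto (fun N : ℕ => (N : ℝ) ^ n * (fwdDiff (1 : ℝ))^[n] (f N) s) atTop
      (nhds (n.factorial * coeff n φ)) := by
  induction n generalizing f φ with
  | zero => simpa using h s
  | succ n ih =>
    have h1 := ih h.2
    have e : (n.factorial : ℝ) * coeff n (derivative ℝ φ) =
        (n + 1).factorial * coeff (n + 1) φ := by
      rw [coeff_derivative, Nat.factorial_succ]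
      push_cast
      ring
    rw [e] at h1
    refine h1.congr fun N => ?_
    have e2 : (fun s => (N : ℝ) * (f N (s + 1) - f N s)) = (N : ℝ) • fwdDiff (1 : ℝ) (f N) := by
      ext s
      simp [fwdDiff]
    rw [e2, fwdDiff_iter_const_smul, Function.iterate_succ_apply, Pi.smul_apply, smul_eq_mul,
      pow_succ]
    ring

end HasScaledJet

theorem coeff_catalan_triangle (n : ℕ) {ℓ : ℝ} (hℓ : 1 + ℓ ≠ 0) :
    coeff n (((C 1 + X) * (C 1 + X) * (C (1 + ℓ) + X)⁻¹ : PowerSeries ℝ) ^ (n + 1)) =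
      (∑ i ∈ range (n + 1), ((n + 1 : ℝ) - i) * ((2 * (n + 1)).choose i : ℝ) * ℓ ^ i) /
        (1 + ℓ) ^ (2 * (n + 1) - 1) := by
  set Y : PowerSeries ℝ := C (1 + ℓ) + X with hY
  have hY1 : Y * Y⁻¹ = 1 := PowerSeries.mul_inv_cancel _ (by simpa [hY] using hℓ)
  have hlin : C (1 + ℓ) * (C 1 + X) = C ℓ * X + Y := by
    rw [hY, map_add, map_one]
    ring
  have hpow : C ((1 + ℓ) ^ (2 * (n + 1))) *
      ((C 1 + X) * (C 1 + X) * Y⁻¹ : PowerSeries ℝ) ^ (n + 1) =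
      ∑ i ∈ range (2 * (n + 1) + 1),
        C (ℓ ^ i * ((2 * (n + 1)).choose i : ℝ)) *
          (Y ^ (2 * (n + 1) - i) * Y⁻¹ ^ (n + 1)) * X ^ i := by
    have : C ((1 + ℓ) ^ (2 * (n + 1))) * ((C 1 + X) * (C 1 + X) * Y⁻¹ : PowerSeries ℝ) ^ (n + 1) =
        (C (1 + ℓ) * (C 1 + X)) ^ (2 * (n + 1)) * Y⁻¹ ^ (n + 1) := by
      rw [map_pow]
      simp only [mul_pow]
      ring
    rw [this, hlin, add_pow, sum_mul]
    refine sum_congr rfl fun i _ => ?_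
    rw [map_mul, map_pow, map_natCast]
    ring
  have hc := congrArg (coeff n) hpow
  rw [coeff_C_mul, map_sum] at hc
  have hsub : range (n + 1) ⊆ range (2 * (n + 1) + 1) := range_subset_range.2 (by omega)
  rw [← sum_subset hsub] at hc
  · have hterm : ∀ i ∈ range (n + 1), coeff n (C (ℓ ^ i * ((2 * (n + 1)).choose i : ℝ)) *
        (Y ^ (2 * (n + 1) - i) * Y⁻¹ ^ (n + 1)) * X ^ i) =
        (1 + ℓ) * (((n + 1 : ℝ) - i) * ((2 * (n + 1)).choose i : ℝ) * ℓ ^ i) := by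
      intro i hi
      obtain ⟨p, rfl⟩ : ∃ p, n = p + i := ⟨n - i, by have := mem_range.1 hi; omega⟩
      have hp : 2 * (p + i + 1) - i = (p + 1) + (p + i + 1) := by omega
      rw [coeff_mul_X_pow, coeff_C_mul, hp, pow_add Y, mul_assoc (Y ^ (p + 1)), ← mul_pow, hY1, one_pow, mul_one,
        hY, add_comm (C (1 + ℓ)) X, add_pow, map_sum, sum_eq_single p]
      · rw [← map_pow, ← map_natCast (C (R := ℝ)), coeff_mul_C, coeff_mul_C, coeff_X_pow_self]
        simp
        ring
      · intro q _ hq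
        rw [← map_pow, ← map_natCast (C (R := ℝ)), coeff_mul_C, coeff_mul_C, coeff_X_pow,
          if_neg (Ne.symm hq), zero_mul, zero_mul]
      · simp
    rw [sum_congr rfl hterm, ← mul_sum] at hc
    have h2 : 2 * (n + 1) - 1 + 1 = 2 * (n + 1) := by omega
    rw [eq_div_iff (pow_ne_zero _ hℓ)]
    rw [← h2, pow_succ] at hc
    apply mul_left_cancel₀ hℓ
    rw [h2] at hc
    linear_combination hc
  · intro i _ hi
    have : n < i := by simpa using hi
    rw [coeff_mul_X_pow', if_neg (by omega)]

end Jet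

theorem Ik_div_N_limit_catalan_triangle (k : ℕ) (hk : 1 ≤ k) (ℓ a₀ b₀ : ℝ)
    (hℓ : 1 ≤ ℓ) (ha₀ : 0 < a₀)
    (hb : ∀ N : ℕ, 1 ≤ N → 0 < (ℓ - 1) * (N : ℝ) + b₀) :
    Filter.Tendsto
      (fun N : ℕ => Ik k N a₀ ((ℓ - 1) * (N : ℝ) + b₀) / (N : ℝ))
      Filter.atTop
      (nhds ((∑ i ∈ Finset.range k,
          (((k : ℝ) - (i : ℝ)) / (k : ℝ)) * ((2 * k).choose i : ℝ) * ℓ ^ i) /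
        (1 + ℓ) ^ (2 * k - 1))) := by
  obtain ⟨n, rfl⟩ : ∃ n, k = n + 1 := ⟨k - 1, by omega⟩
  have hL : (1 + ℓ) ≠ 0 := by linarith
  have hjet : HasScaledJet n (fun N s => ∏ m ∈ range (n + 1),
      (1 + (s + (m : ℝ)) / N) * (1 + (s + (m + a₀ - 1)) / N) *
        ((1 + ℓ) + (s + (m + a₀ + b₀ - 2)) / N)⁻¹)
      (((PowerSeries.C 1 + PowerSeries.X) * (PowerSeries.C 1 + PowerSeries.X) *
        (PowerSeries.C (1 + ℓ) + PowerSeries.X)⁻¹) ^ (n + 1)) :=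
    .prod_range (fun m => ((HasScaledJet.affine 1 _).mul (.affine 1 _)).mul (.affine_inv hL _)) _
  have hlim := (hjet.tendsto_fwdDiff (-(n : ℝ))).const_mul ((((n + 1).factorial : ℝ))⁻¹)
  rw [coeff_catalan_triangle n hL] at hlim
  have hval : (((n + 1).factorial : ℝ))⁻¹ * (n.factorial *
      ((∑ i ∈ range (n + 1), ((n + 1 : ℝ) - i) * ((2 * (n + 1)).choose i : ℝ) * ℓ ^ i) /
        (1 + ℓ) ^ (2 * (n + 1) - 1))) =
      (∑ i ∈ Finset.range (n + 1), ((((n + 1 : ℕ) : ℝ) - (i : ℝ)) / ((n + 1 : ℕ) : ℝ)) *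
        ((2 * (n + 1)).choose i : ℝ) * ℓ ^ i) / (1 + ℓ) ^ (2 * (n + 1) - 1) := by
    have h1 : (n.factorial : ℝ) ≠ 0 := by positivity
    have h2 : (n + 1 : ℝ) ≠ 0 := by positivity
    rw [← mul_assoc, ← mul_div_assoc, mul_sum]
    congr 1
    refine sum_congr rfl fun i _ => ?_
    rw [Nat.factorial_succ]
    push_cast
    field_simp
  rw [hval] at hlim
  refine hlim.congr' ?_
  filter_upwards [Filter.eventually_ge_atTop (n + 1)] with N hN
  have hN0 : (N : ℝ) ≠ 0 := by
    have : N ≠ 0 := by omega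
    exact_mod_cast this
  rw [Ik_eq_alternating_sum ha₀ (hb N (by omega)) hN, fwdDiff_iter_eq_sum_shift,
    ← sum_range_reflect, mul_div_assoc, mul_sum, sum_div]
  congr 1
  refine sum_congr rfl fun r hr => ?_
  have hr' : r ≤ n := Nat.lt_succ_iff.1 (mem_range.1 hr)
  have e1 : n + 1 - 1 - r = n - r := by omega
  have e2 : n - (n - r) = r := by omega
  have e3 : -(n : ℝ) + (n - r) • (1 : ℝ) = -r := by
    rw [nsmul_eq_mul, Nat.cast_sub hr']
    ring
  have hprod : ∏ m ∈ range (n + 1), ((N : ℝ) - r + m) * (N - 1 - r + a₀ + m) /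
      (a₀ + ((ℓ - 1) * (N : ℝ) + b₀) + 2 * N - 2 - r + m) =
      (N : ℝ) ^ (n + 1) * ∏ m ∈ range (n + 1),
        (1 + (-r + (m : ℝ)) / N) * (1 + (-r + (m + a₀ - 1)) / N) *
        ((1 + ℓ) + (-r + (m + a₀ + b₀ - 2)) / N)⁻¹ := by
    nth_rw 2 [← card_range (n + 1)]
    rw [← prod_const, ← prod_mul_distrib]
    refine prod_congr rfl fun m _ => ?_
    have h1 : (N : ℝ) - r + m = N * (1 + (-r + (m : ℝ)) / N) := by
      field_simp
      ring
    have h2 : (N : ℝ) - 1 - r + a₀ + m = N * (1 + (-r + (m + a₀ - 1)) / N) := by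
      field_simp
      ring
    have h3 : a₀ + ((ℓ - 1) * (N : ℝ) + b₀) + 2 * N - 2 - r + m =
        N * ((1 + ℓ) + (-r + (m + a₀ + b₀ - 2)) / N) := by
      field_simp
      ring
    rw [h1, h2, h3, div_eq_mul_inv, mul_inv]
    field_simp
  rw [e1, e2, e3, hprod, Nat.choose_symm hr', zsmul_eq_mul, pow_succ]
  push_cast
  field_simp
end
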